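/- Let X ⊆ A^ℤ be an aperiodic Toeplitz subshift. The following are equivalent: (1) X is a strong Toeplitz subshift of rank 2; (2) for every x ∈ X, every positive integer p dividing the scale of X, and every m ∈ ℕ, there is a strong rank-2 cut (q,t) of x such that p | q, q divides the scale of X, and the maximal common prefix and the maximal common suffix of the two elements of { x[t+kq, t+(k+1)q) : k ∈ ℤ } both have length greater than m; (3) statement (2) holds for at least one x ∈ X. -/

import Mathlib

namespace ToeplitzFR

open Set

variable {A B C : Type*}

/-- The shift map `S` on `ℤ → A`: `S(x)(i) = x(i+1)`. -/
def shift (x : ℤ → A) : ℤ → A := fun i => x (i + 1)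

/-- The inverse shift map `S⁻¹`. -/
def shiftInv (x : ℤ → A) : ℤ → A := fun i => x (i - 1)

/-- The shift by `k`: `S^k`. -/
def shiftBy (k : ℤ) (x : ℤ → A) : ℤ → A := fun i => x (i + k)

/-- The finite word `x[i, i+n)`. -/
def factorAt (x : ℤ → A) (i : ℤ) (n : ℕ) : List A :=
  (List.range n).map fun j => x (i + j)

/-- `x` is a periodic point of the shift. -/
def IsPeriodicPoint (x : ℤ → A) : Prop := ∃ p : ℕ, 0 < p ∧ ∀ i : ℤ, x (i + p) = x i

def IsAperiodicPoint (x : ℤ → A) : Prop := ¬ IsPeriodicPoint x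

/-- `Per_p(x)`. -/
def PerSet (x : ℤ → A) (p : ℕ) : Set ℤ := {i : ℤ | ∀ k : ℤ, x (i + k * p) = x i}

/-- `Per(x) = ⋃_{p>1} Per_p(x)`. -/
def PerAll (x : ℤ → A) : Set ℤ := {i : ℤ | ∃ p : ℕ, 1 < p ∧ i ∈ PerSet x p}

/-- `x` is a Toeplitz sequence. -/
def IsToeplitz (x : ℤ → A) : Prop := ∀ i : ℤ, ∃ p : ℕ, 1 < p ∧ i ∈ PerSet x p

/-- The shift orbit of `x`. -/
def orbit (x : ℤ → A) : Set (ℤ → A) := {y | ∃ k : ℤ, y = shiftBy k x}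

/-- `X` is the Toeplitz subshift generated by the Toeplitz sequence `x`. -/
def ToeplitzGenerates [TopologicalSpace A] (x : ℤ → A) (X : Set (ℤ → A)) : Prop :=
  IsToeplitz x ∧ X = closure (orbit x)

/-- `X` is a Toeplitz subshift. -/
def IsToeplitzSubshift [TopologicalSpace A] (X : Set (ℤ → A)) : Prop :=
  ∃ x : ℤ → A, ToeplitzGenerates x X

/-- The `p`-skeleton of `x`, with `none` as the blank symbol. -/
noncomputable def Skel (x : ℤ → A) (p : ℕ) : ℤ → Option A :=
  fun i => @ite _ (i ∈ PerSet x p) (Classical.dec _) (some (x i)) none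

/-- `p` is an essential period of `x`. -/
def IsEssentialPeriod (x : ℤ → A) (p : ℕ) : Prop :=
  1 < p ∧ ∀ q : ℕ, 0 < q → q < p → ∃ i : ℤ, Skel x p (i + q) ≠ Skel x p i

/-- `(P n)` is a period structure for `x`. -/
def IsPeriodStructure (x : ℤ → A) (P : ℕ → ℕ) : Prop :=
  StrictMono P ∧ (∀ n, IsEssentialPeriod x (P n)) ∧ (∀ n, P n ∣ P (n+1)) ∧
    ∀ i : ℤ, ∃ n, i ∈ PerSet x (P n)

/-- `q` divides the scale of the Toeplitz subshift `X`. -/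
def DividesScale [TopologicalSpace A] (X : Set (ℤ → A)) (q : ℕ) : Prop :=
  ∃ (x : ℤ → A) (P : ℕ → ℕ),
    ToeplitzGenerates x X ∧ IsPeriodStructure x P ∧ ∃ n, q ∣ P n

/-! ### Directive sequences and S-adic subshifts -/

/-- All morphisms in the directive sequence are non-erasing. -/
def NonErasing {A : ℕ → Type*} (τ : ∀ n, A (n+1) → List (A n)) : Prop :=
  ∀ n a, τ n a ≠ []

/-- The directive sequence has constant length. -/
def ConstantLength {A : ℕ → Type*} (τ : ∀ n, A (n+1) → List (A n)) : Prop :=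
  ∀ n, ∀ a b : A (n+1), (τ n a).length = (τ n b).length

/-- The directive sequence is proper. -/
def ProperSeq {A : ℕ → Type*} (τ : ∀ n, A (n+1) → List (A n)) : Prop :=
  ∀ n, ∃ b c : A n, ∀ a : A (n+1), (τ n a).head? = some b ∧ (τ n a).getLast? = some c

/-- `sadicWordAux τ n k a = τ_{[n, n+k)}(a)`. -/
def sadicWordAux {A : ℕ → Type*} (τ : ∀ n, A (n+1) → List (A n)) (n : ℕ) :
    ∀ k : ℕ, A (n + k) → List (A n)
  | 0, a => [a]
  | (k+1), a => (τ (n+k) a).flatMap (sadicWordAux τ n k)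

/-- `word0 τ k a = τ_{[0, k)}(a)` for `a ∈ A k`. -/
def word0 {A : ℕ → Type*} (τ : ∀ n, A (n+1) → List (A n)) :
    ∀ k : ℕ, A k → List (A 0)
  | 0, a => [a]
  | (k+1), a => (τ k a).flatMap (word0 τ k)

/-- The directive sequence is primitive. -/
def PrimitiveSeq {A : ℕ → Type*} (τ : ∀ n, A (n+1) → List (A n)) : Prop :=
  ∀ n, ∃ k : ℕ, 0 < k ∧ ∀ (a : A (n+k)) (b : A n), b ∈ sadicWordAux τ n k a

/-- The `n`-th level `X_τ^{(n)}` of the S-adic system generated by `τ`. -/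
def XLevel {A : ℕ → Type*} (τ : ∀ n, A (n+1) → List (A n)) (n : ℕ) :
    Set (ℤ → A n) :=
  {y | ∀ (i : ℤ) (m : ℕ), ∃ k : ℕ, 0 < k ∧ ∃ a : A (n+k),
      (factorAt y i m).IsInfix (sadicWordAux τ n k a)}

/-- The alphabet rank (`liminf_n |A_n|`) is at most `K`. -/
def AlphabetRankLE (A : ℕ → Type*) [∀ n, Fintype (A n)] (K : ℕ) : Prop :=
  ∀ N : ℕ, ∃ n, N ≤ n ∧ Fintype.card (A n) ≤ K

/-! ### Recognizability -/

/-- `z` is the bi-infinite concatenation `⋯σ(y(-1)).σ(y(0))σ(y(1))⋯`,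
with `σ(y(0))` starting at coordinate `0`. -/
def IsConcat (σ : B → List C) (y : ℤ → B) (z : ℤ → C) : Prop :=
  ∃ c : ℤ → ℤ, c 0 = 0 ∧ (∀ j : ℤ, c (j + 1) = c j + (σ (y j)).length) ∧
    ∀ (j : ℤ) (m : Fin (σ (y j)).length), z (c j + (m : ℕ)) = (σ (y j)).get m

/-- `(y, k)` is a centered `σ`-representation of `x` in `Y`. -/
def IsCenteredRep (σ : B → List C) (Y : Set (ℤ → B)) (x : ℤ → C)
    (y : ℤ → B) (k : ℕ) : Prop :=
  y ∈ Y ∧ k < (σ (y 0)).length ∧ IsConcat σ y (fun m => x (m - k))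

/-- The morphism `σ` is recognizable in `Y`. -/
def RecognizableIn (σ : B → List C) (Y : Set (ℤ → B)) : Prop :=
  ∀ (x : ℤ → C) (y y' : ℤ → B) (k k' : ℕ),
    IsCenteredRep σ Y x y k → IsCenteredRep σ Y x y' k' → y = y' ∧ k = k'

/-- The directive sequence `τ` is recognizable. -/
def RecognizableSeq {A : ℕ → Type*} (τ : ∀ n, A (n+1) → List (A n)) : Prop :=
  ∀ n, RecognizableIn (τ n) (XLevel τ (n+1))

/-! ### Conjugacy -/

/-- `(X, TX)` and `(Y, TY)` are conjugate via a homeomorphism. -/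
def ConjugateBy [TopologicalSpace A] [TopologicalSpace B]
    (X : Set (ℤ → A)) (Y : Set (ℤ → B))
    (TX : (ℤ → A) → (ℤ → A)) (TY : (ℤ → B) → (ℤ → B)) : Prop :=
  ∃ φ : ↥X ≃ₜ ↥Y, ∀ (x : ℤ → A) (hx : x ∈ X) (hx' : TX x ∈ X),
    (φ ⟨TX x, hx'⟩).1 = TY (φ ⟨x, hx⟩).1

/-- `(X, S)` and `(Y, S)` are conjugate subshifts. -/
def Conjugate [TopologicalSpace A] [TopologicalSpace B]
    (X : Set (ℤ → A)) (Y : Set (ℤ → B)) : Prop :=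
  ConjugateBy X Y shift shift

/-- `X` is a strong Toeplitz subshift of rank `K`: it is conjugate to the S-adic subshift
of a constant-length, primitive, proper and recognizable directive sequence of
alphabet rank at most `K`. -/
def IsStrongToeplitzOfRank [TopologicalSpace A] (X : Set (ℤ → A)) (K : ℕ) : Prop :=
  ∃ (B : ℕ → Type) (iB : ∀ n, Fintype (B n)) (σ : ∀ n, B (n+1) → List (B n)),
    NonErasing σ ∧ ConstantLength σ ∧ PrimitiveSeq σ ∧ ProperSeq σ ∧
    RecognizableSeq σ ∧ @AlphabetRankLE B iB K ∧
    @Conjugate A (B 0) _ ⊥ X (XLevel σ 0)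

/-- `X` is conjugate to the S-adic subshift of a primitive, proper and recognizable
directive sequence of alphabet rank at most `K`. -/
def HasFiniteRankSAdicRep [TopologicalSpace A] (X : Set (ℤ → A)) (K : ℕ) : Prop :=
  ∃ (B : ℕ → Type) (iB : ∀ n, Fintype (B n)) (σ : ∀ n, B (n+1) → List (B n)),
    NonErasing σ ∧ PrimitiveSeq σ ∧ ProperSeq σ ∧
    RecognizableSeq σ ∧ @AlphabetRankLE B iB K ∧
    @Conjugate A (B 0) _ ⊥ X (XLevel σ 0)

/-! ### Cuts, languages, built-from -/

/-- The set of words `{x[t+kp, t+(k+1)p) : k ∈ ℤ}`. -/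
def cutWords (x : ℤ → A) (p t : ℕ) : Set (List A) :=
  {w | ∃ k : ℤ, w = factorAt x ((t : ℤ) + k * p) p}

/-- `(p, t)` is a strong rank-2 cut of `x`. -/
def StrongRank2Cut (x : ℤ → A) (p t : ℕ) : Prop :=
  t < p ∧ ∃ u v : List A, u ≠ v ∧ cutWords x p t = {u, v}

/-- The language `L_n(X)`. -/
def Lang (n : ℕ) (X : Set (ℤ → A)) : Set (List A) :=
  {w | ∃ x ∈ X, ∃ i : ℤ, w = factorAt x i n}

/-- The maximal common prefix of `u` and `v` has length greater than `m`. -/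
def CommonPrefixLongerThan (u v : List A) (m : ℕ) : Prop :=
  m + 1 ≤ u.length ∧ m + 1 ≤ v.length ∧ u.take (m+1) = v.take (m+1)

/-- The maximal common suffix of `u` and `v` has length greater than `m`. -/
def CommonSuffixLongerThan (u v : List A) (m : ℕ) : Prop :=
  CommonPrefixLongerThan u.reverse v.reverse m

/-- `b = (β₀, (α₁, …, α_k), β₁)` is a building of the word `w` from `W`:
`w = β₀α₁⋯α_kβ₁`, all `αᵢ ∈ W`, `β₀` is a proper suffix of an element of `W`,
and `β₁` is a proper prefix of an element of `W`. -/
def IsBuilding (W : Set (List A)) (w : List A)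
    (b : List A × List (List A) × List A) : Prop :=
  w = b.1 ++ b.2.1.flatten ++ b.2.2 ∧ (∀ α ∈ b.2.1, α ∈ W) ∧
  (∃ u ∈ W, b.1 <:+ u ∧ b.1 ≠ u) ∧ (∃ u ∈ W, b.2.2 <+: u ∧ b.2.2 ≠ u)

/-- `w` is uniquely built from `W`. -/
def UniquelyBuiltFrom (W : Set (List A)) (w : List A) : Prop :=
  ∃! b : List A × List (List A) × List A, IsBuilding W w b

/-- `X` together with one of its points satisfies the strong rank-2 cut property. -/
def GoodCuts [TopologicalSpace A] (X : Set (ℤ → A)) (x : ℤ → A) : Prop :=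
  ∀ p : ℕ, 0 < p → DividesScale X p → ∀ m : ℕ,
    ∃ q t : ℕ, StrongRank2Cut x q t ∧ p ∣ q ∧ DividesScale X q ∧
      ∃ u v : List A, u ≠ v ∧ cutWords x q t = {u, v} ∧
        CommonPrefixLongerThan u v m ∧ CommonSuffixLongerThan u v m

/-! ### Euclidean pairs and buildings of bi-infinite sequences -/

/-- `{u, v}` is a Euclidean pair. -/
def EuclideanPair (u v : List A) : Prop :=
  ∃ (w : List A) (k l : ℕ),
    u = (List.replicate k w).flatten ∧ v = (List.replicate l w).flatten

/-- `α` is the distinguished prefix of `u` and `v`. -/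
def IsDistinguishedPrefix (u v α : List A) : Prop :=
  α.length < u.length + v.length ∧
  ∀ x y : List A,
    (∃ l : List (List A), (∀ w ∈ l, w = u ∨ w = v) ∧ x = u ++ l.flatten) →
    (∃ l : List (List A), (∀ w ∈ l, w = u ∨ w = v) ∧ y = v ++ l.flatten) →
    α.length + 1 ≤ x.length → α.length + 1 ≤ y.length →
    α <+: x ∧ α <+: y ∧ x[α.length]? ≠ y[α.length]?

/-- `β` is the distinguished suffix of `u` and `v`. -/
def IsDistinguishedSuffix (u v β : List A) : Prop :=
  IsDistinguishedPrefix u.reverse v.reverse β.reverse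

/-- `(c, f)` is a building of the bi-infinite sequence `x` from `W`:
block `j` starts at position `c j` and carries the word `f j ∈ W`. -/
def IsBuildingSeq (W : Set (List A)) (x : ℤ → A) (c : ℤ → ℤ) (f : ℤ → List A) : Prop :=
  (∀ j : ℤ, f j ∈ W) ∧ (∀ j : ℤ, c (j + 1) = c j + (f j).length) ∧
  ∀ (j : ℤ) (m : Fin (f j).length), x (c j + (m : ℕ)) = (f j).get m

/-- The subshift `X_{u,v}` of all sequences built from `{u, v}`. -/
def Xuv (u v : List A) : Set (ℤ → A) :=
  {x | ∃ (c : ℤ → ℤ) (f : ℤ → List A), IsBuildingSeq {u, v} x c f}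

/-! ### Block-code conjugacies -/

/-- A conjugacy `φ : X → Y` admitting block width `2n+1`. -/
structure BlockConjugacy (A : Type*) (X Y : Set (ℤ → A)) (n : ℕ) where
  toFun : (ℤ → A) → (ℤ → A)
  invFun : (ℤ → A) → (ℤ → A)
  maps_to : ∀ x ∈ X, toFun x ∈ Y
  maps_from : ∀ y ∈ Y, invFun y ∈ X
  left_inv : ∀ x ∈ X, invFun (toFun x) = x
  right_inv : ∀ y ∈ Y, toFun (invFun y) = y
  shift_comm : ∀ x ∈ X, toFun (shift x) = shift (toFun x)
  code : List A → A
  code_inv : List A → A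
  code_spec : ∀ x ∈ X, ∀ i : ℤ, toFun x i = code (factorAt x (i - n) (2*n+1))
  code_inv_spec : ∀ y ∈ Y, ∀ i : ℤ, invFun y i = code_inv (factorAt y (i - n) (2*n+1))

/-! ### Parts, permutation action, χ -/

/-- `W` is a member of `Parts(X, p)`: a class of the common-`p`-skeleton relation. -/
def SkelClass (X : Set (ℤ → A)) (p : ℕ) (W : Set (ℤ → A)) : Prop :=
  ∃ y ∈ X, W = {z ∈ X | Skel z p = Skel y p}

/-- The map `ψ̂` induced by a permutation `ψ` of `A^p`. -/
def permHat (p : ℕ) (ψ : Equiv.Perm (Fin p → A)) (x : ℤ → A) : ℤ → A :=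
  fun i =>
    if h : (i.emod p).toNat < p then
      ψ (fun m : Fin p => x (i - i.emod p + (m : ℕ))) ⟨(i.emod p).toNat, h⟩
    else x i

/-- The relation `E_p` on compact subsets of `A^ℤ`. -/
def EpRel (p : ℕ) (K L : Set (ℤ → A)) : Prop :=
  ∃ ψ : Equiv.Perm (Fin p → A), L = permHat p ψ '' K

/-- `W ∈ Parts_*(X, p)`. -/
def SkelClassStar (X : Set (ℤ → A)) (p : ℕ) (W : Set (ℤ → A)) : Prop :=
  SkelClass X p W ∧ ∀ y ∈ W, Skel y p (-1) = none ∧ Skel y p 0 ≠ none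

/-- `length(W) = L` for `W ∈ Parts_*(X, p)`. -/
def HasLength (p : ℕ) (W : Set (ℤ → A)) (L : ℕ) : Prop :=
  ∀ y ∈ W, (∀ i : ℕ, i < L → Skel y p (i : ℤ) ≠ none) ∧ Skel y p (L : ℤ) = none

/-- `Z ∈ χ(X, p)`. -/
def ChiMem (X : Set (ℤ → A)) (p : ℕ) (Z : Set (ℤ → A)) : Prop :=
  ∃ (W : Set (ℤ → A)) (L : ℕ), SkelClassStar X p W ∧ HasLength p W L ∧
    (∀ (W' : Set (ℤ → A)) (L' : ℕ),
      SkelClassStar X p W' → HasLength p W' L' → L' ≤ L) ∧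
    Z = shiftBy ((L / 2 : ℕ) : ℤ) '' W

/-- `χ(X, p) E_p^fin χ(Y, p)`. -/
def ChiEpFin (X Y : Set (ℤ → A)) (p : ℕ) : Prop :=
  (∀ K, ChiMem X p K → ∃ L, ChiMem Y p L ∧ EpRel p K L) ∧
  (∀ L, ChiMem Y p L → ∃ K, ChiMem X p K ∧ EpRel p K L)

/-! ### Single holes and fillings -/

/-- The Toeplitz sequence `x` has single holes with respect to the period structure `P`. -/
def SingleHoles (x : ℤ → A) (P : ℕ → ℕ) : Prop :=
  IsPeriodStructure x P ∧
  ∀ n, ∃! i : ℤ, 0 ≤ i ∧ i < (P n : ℤ) ∧ i ∉ PerSet x (P n)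

/-- The Toeplitz subshift `X` has single holes. -/
def HasSingleHoles [TopologicalSpace A] (X : Set (ℤ → A)) : Prop :=
  ∃ (x : ℤ → A) (P : ℕ → ℕ), ToeplitzGenerates x X ∧ SingleHoles x P

/-- `w` is the `(n, m)`-filling of `x` (for periods `pn < pm`). -/
def IsFilling (x : ℤ → A) (pn pm : ℕ) (w : List A) : Prop :=
  w.length = pm / pn - 1 ∧
  ∀ h : ℤ, 0 ≤ h → h < (pm : ℤ) → h ∉ PerSet x pm →
    ∀ (j : ℕ) (hj : j < w.length), w.get ⟨j, hj⟩ = x (h + (j+1) * pn)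

/-- `u` is a `θ`-palindrome. -/
def ThetaPalindrome (θ : Equiv.Perm A) (u : List A) : Prop :=
  u.map (fun a => θ a) = u.reverse

/-! ### Nice symmetries -/

/-- `x` has nice symmetries with respect to `(p, q)`. -/
def NiceSymmetries (x : ℤ → A) (p q : ℕ) : Prop :=
  ∃ m : ℤ, 1 < m ∧ m ≤ (q : ℤ) + 1 ∧
    (∀ k : ℕ, k < q / p →
      (Set.Ico ((k * p : ℕ) : ℤ) (((k+1) * p : ℕ) : ℤ) ⊆ PerSet x q ↔
       Set.Ico (m - ((k+1) * p : ℕ)) (m - (k * p : ℕ)) ⊆ PerSet x q)) ∧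
    (∀ k k' : ℕ, k < q / p → k' < q / p →
      Set.Ico ((k * p : ℕ) : ℤ) (((k+1) * p : ℕ) : ℤ) ⊆ PerSet x q →
      Set.Ico ((k' * p : ℕ) : ℤ) (((k'+1) * p : ℕ) : ℤ) ⊆ PerSet x q →
      (factorAt x ((k * p : ℕ) : ℤ) p = factorAt x ((k' * p : ℕ) : ℤ) p ↔
       factorAt x (m - ((k+1) * p : ℕ)) p = factorAt x (m - ((k'+1) * p : ℕ)) p))

/-- For some `p` dividing the scale of `X`, `x` has nice symmetries with respect to
`(p, q)` for all `q > p` with `p ∣ q` dividing the scale of `X`. -/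
def NiceSymAll [TopologicalSpace A] (X : Set (ℤ → A)) (x : ℤ → A) : Prop :=
  ∃ p : ℕ, 0 < p ∧ DividesScale X p ∧
    ∀ q : ℕ, p < q → p ∣ q → DividesScale X q → NiceSymmetries x p q

/-- A pair `(x, x')` is a centered left asymptotic pair. -/
def CenteredLeftAsymptoticPair (x x' : ℤ → A) : Prop :=
  (∀ i : ℤ, i < 0 → x i = x' i) ∧ x 0 ≠ x' 0

/-! ### Automorphism groups -/

/-- `e` is an automorphism of the subshift `(X, S)`. -/
def IsShiftAutomorphism [TopologicalSpace A] (X : Set (ℤ → A)) (e : ↥X ≃ₜ ↥X) : Prop :=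
  ∀ (x : ℤ → A) (hx : x ∈ X) (hx' : shift x ∈ X),
    (e ⟨shift x, hx'⟩).1 = shift (e ⟨x, hx⟩).1

/-- The automorphism group of `(X, S)` is isomorphic, as a group, to `ℤ × ℤ/nℤ`. -/
def AutGroupIsoZxZmod [TopologicalSpace A] (X : Set (ℤ → A)) (n : ℕ) : Prop :=
  ∃ Φ : {e : ↥X ≃ₜ ↥X // IsShiftAutomorphism X e} → ℤ × ZMod n,
    Function.Bijective Φ ∧
    ∀ e f g : {e : ↥X ≃ₜ ↥X // IsShiftAutomorphism X e},
      (∀ z : ↥X, g.1 z = e.1 (f.1 z)) → Φ g = Φ e + Φ f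

/-! ### The Polish space of subshifts over `ℤ` -/

/-- A point of the space `𝐒` of all (compact, nonempty, shift-invariant) subshifts
over finite alphabets contained in `ℤ`. -/
structure SubshiftSpace : Type where
  carrier : Set (ℤ → ℤ)
  nonempty : carrier.Nonempty
  compact : IsCompact carrier
  invariant : shift '' carrier = carrier

/-- The topology on `𝐒` induced by the languages `(L_n(X))_{n}`, with each
family of `n`-languages discrete; this coincides with the metric
`d(X,Y) = 2^{-min{n : L_n(X) ≠ L_n(Y)}}`. -/
instance : TopologicalSpace SubshiftSpace :=
  TopologicalSpace.induced
    (fun X : SubshiftSpace => (fun n => Lang n X.carrier : ℕ → Set (List ℤ)))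
    (@Pi.topologicalSpace ℕ (fun _ => Set (List ℤ)) (fun _ => ⊥))

/-- The subset `𝐌 ⊆ 𝐒` of infinite minimal subshifts. -/
def MinimalSet : Set SubshiftSpace :=
  {X | X.carrier.Infinite ∧ ∀ x ∈ X.carrier, X.carrier ⊆ closure (orbit x)}

/-! ### Toeplitz generalities -/

theorem PerSet_mono {x : ℤ → A} {p q : ℕ} (h : p ∣ q) : PerSet x p ⊆ PerSet x q := by
  intro i hi k
  obtain ⟨c, rfl⟩ := h
  have := hi (k * c)
  rw [← this]; congr 1; push_cast; ring

theorem PerSet_add {x : ℤ → A} {p : ℕ} {i : ℤ} (hi : i ∈ PerSet x p) (k : ℤ) :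
    i + k * p ∈ PerSet x p := by
  intro l
  rw [hi k, ← hi (k + l)]; congr 1; ring

theorem exists_common_period {x : ℤ → A} (hx : IsToeplitz x) (i : ℤ) (n : ℕ) :
    ∃ p : ℕ, 0 < p ∧ ∀ m : ℕ, m < n → i + m ∈ PerSet x p := by
  induction n with
  | zero => exact ⟨1, one_pos, fun m hm => absurd hm (Nat.not_lt_zero _)⟩
  | succ n ih =>
    obtain ⟨p, hp, h⟩ := ih
    obtain ⟨p', hp', h'⟩ := hx (i + n)
    refine ⟨p * p', Nat.mul_pos hp (by omega), fun m hm => ?_⟩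
    rcases Nat.lt_succ_iff_lt_or_eq.mp hm with h1 | rfl
    · exact PerSet_mono (Dvd.intro _ rfl) (h m h1)
    · exact PerSet_mono (Dvd.intro_left _ rfl) h'

/-- Every factor of a point of the orbit closure is a factor of the generator. -/
theorem factor_of_closure [TopologicalSpace A] [DiscreteTopology A] {x y : ℤ → A}
    (hy : y ∈ closure (orbit x)) (i : ℤ) (n : ℕ) :
    ∃ j : ℤ, ∀ m : ℕ, m < n → x (j + m) = y (i + m) := by
  let U : Set (ℤ → A) := ⋂ m ∈ Finset.range n, {z | z (i + m) = y (i + m)}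
  have hU : IsOpen U := by
    apply isOpen_biInter_finset
    intro m _
    exact (isOpen_discrete ({y (i + m)} : Set A)).preimage
      (continuous_apply (A := fun _ : ℤ => A) (i + (m:ℤ)))
  obtain ⟨z, hzU, k, rfl⟩ := mem_closure_iff.mp hy U hU (by simp [U])
  refine ⟨i + k, fun m hm => ?_⟩
  have := Set.mem_iInter₂.mp hzU m (Finset.mem_range.mpr hm)
  simp only [shiftBy, Set.mem_ofPred_eq] at this
  rw [← this]; congr 1; ring

theorem mem_closure_of_factor [TopologicalSpace A] [DiscreteTopology A] {x y : ℤ → A}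
    (h : ∀ (i : ℤ) (n : ℕ), ∃ j : ℤ, ∀ m : ℕ, m < n → x (j + m) = y (i + m)) :
    y ∈ closure (orbit x) := by
  rw [mem_closure_iff]
  intro U hU hyU
  obtain ⟨I, u, hu, hsub⟩ := isOpen_pi_iff.mp hU y hyU
  obtain ⟨N, hN⟩ : ∃ N : ℕ, ∀ i ∈ I, i.natAbs ≤ N :=
    ⟨I.sup Int.natAbs, fun i hi => Finset.le_sup (f := Int.natAbs) hi⟩
  obtain ⟨j, hj⟩ := h (-N) (2 * N + 1)
  refine ⟨shiftBy (j + N) x, hsub ?_, ⟨_, rfl⟩⟩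
  intro i hi
  have h1 := hN i hi
  have h2 := hj (i + N).toNat (by omega)
  have h3 : (((i + N).toNat : ℕ) : ℤ) = i + N := by omega
  rw [h3] at h2
  have h4 : shiftBy (j + N) x i = y i := by
    simp only [shiftBy]
    rw [show i + (j + N) = j + (i + N) by ring, h2]; congr 1; ring
  rw [h4]
  exact (hu i hi).2

theorem generator_mem [TopologicalSpace A] {x : ℤ → A} {X : Set (ℤ → A)}
    (h : ToeplitzGenerates x X) : x ∈ X := by
  rw [h.2]; exact subset_closure ⟨0, by funext i; simp [shiftBy]⟩

/-- Uniform recurrence. -/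
theorem unif_rec [TopologicalSpace A] [DiscreteTopology A] {X : Set (ℤ → A)}
    (hX : IsToeplitzSubshift X) {x x' : ℤ → A} (hx : x ∈ X) (hx' : x' ∈ X) (i : ℤ) (n : ℕ) :
    ∃ L : ℕ, ∀ s : ℤ, ∃ s', s ≤ s' ∧ s' ≤ s + L ∧ ∀ m : ℕ, m < n → x (s' + m) = x' (i + m) := by
  obtain ⟨x0, hT, rfl⟩ := hX
  obtain ⟨j, hj⟩ := factor_of_closure hx' i n
  obtain ⟨p, hp, hper⟩ := exists_common_period hT j n
  refine ⟨p, fun s => ?_⟩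
  obtain ⟨s0, hs0⟩ := factor_of_closure hx s (p + n)
  have hpz : (0:ℤ) < p := by exact_mod_cast hp
  have hm := Int.emod_nonneg (j - s0) hpz.ne'
  have hm2 := Int.emod_lt_of_pos (j - s0) hpz
  have hd := Int.mul_ediv_add_emod (j - s0) p
  set r := (j - s0) % p
  set d := (j - s0) / p
  refine ⟨s + r, by omega, by omega, fun m hmn => ?_⟩
  have h1 := hs0 (r.toNat + m) (by omega)
  have h2 := hper m hmn (-d)
  rw [← hj m hmn, ← h2]
  rw [show s + r + (m:ℤ) = s + ((r.toNat + m : ℕ) : ℤ) by push_cast; omega, ← h1]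
  congr 1
  push_cast
  rw [show ((r.toNat : ℕ) : ℤ) = r by omega]
  linarith [mul_comm d (p:ℤ)]

/-- Windows of radius `N` in `x` determine the position mod `q`. -/
def Al (x : ℤ → A) (q N : ℕ) : Prop :=
  ∀ a b : ℤ, (∀ i : ℤ, -N ≤ i → i ≤ N → x (a + i) = x (b + i)) → (q : ℤ) ∣ a - b

theorem Al.transfer [TopologicalSpace A] [DiscreteTopology A] {X : Set (ℤ → A)}
    (hX : IsToeplitzSubshift X) {x x' : ℤ → A} (hx : x ∈ X) (hx' : x' ∈ X) {q N : ℕ}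
    (h : Al x q N) : Al x' q N := by
  intro a b hab
  wlog hle : a ≤ b generalizing a b
  · have := this b a (fun i h1 h2 => (hab i h1 h2).symm) (by omega)
    rw [← neg_sub]; exact (dvd_neg).mpr this
  obtain ⟨L, hL⟩ := unif_rec hX hx hx' (a - N) ((b - a).toNat + 2 * N + 1)
  obtain ⟨s, -, -, hs⟩ := hL 0
  have key : ∀ u : ℤ, -N ≤ u → u ≤ (b - a) + N → x (s + N + u) = x' (a + u) := by
    intro u h1 h2
    have := hs (u + N).toNat (by omega)
    rw [show (((u + N).toNat : ℕ) : ℤ) = u + N by omega] at this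
    rw [show s + N + u = s + (u + N) by ring, this]; congr 1; ring
  have := h (s + N) (s + N + (b - a)) (fun i h1 h2 => by
    rw [key i h1 (by omega), show s + N + (b - a) + i = s + N + (b - a + i) by ring,
      key _ (by omega) (by omega), hab i h1 h2]; congr 1; ring)
  rw [show a - b = s + N - (s + N + (b - a)) by ring]; exact this

/-- Aligned uniform recurrence. -/
theorem unif_rec_al [TopologicalSpace A] [DiscreteTopology A] {X : Set (ℤ → A)}
    (hX : IsToeplitzSubshift X) {x : ℤ → A} (hx : x ∈ X) {q N : ℕ} (hal : Al x q N)
    (i : ℤ) (n : ℕ) :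
    ∃ L : ℕ, ∀ s : ℤ, ∃ s', s ≤ s' ∧ s' ≤ s + L ∧ (q : ℤ) ∣ s' - i ∧
      ∀ m : ℕ, m < n → x (s' + m) = x (i + m) := by
  obtain ⟨L, hL⟩ := unif_rec hX hx hx (i - N) (2 * N + 1 + n)
  refine ⟨L + N, fun s => ?_⟩
  obtain ⟨s', h1, h2, h3⟩ := hL s
  have key : ∀ u : ℤ, -N ≤ u → u ≤ n + N → x (s' + N + u) = x (i + u) := by
    intro u h1 h2
    have := h3 (u + N).toNat (by omega)
    rw [show (((u + N).toNat : ℕ) : ℤ) = u + N by omega] at this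
    rw [show s' + N + u = s' + (u + N) by ring, this]; congr 1; ring
  refine ⟨s' + N, by omega, by push_cast; omega, ?_, fun m hm => key m (by omega) (by omega)⟩
  exact hal _ _ (fun u h4 h5 => key u h4 (by omega))

theorem Skel_some {x : ℤ → A} {p : ℕ} {i : ℤ} (h : i ∈ PerSet x p) :
    Skel x p i = some (x i) := by simp [Skel, h]

theorem Skel_none {x : ℤ → A} {p : ℕ} {i : ℤ} (h : i ∉ PerSet x p) :
    Skel x p i = none := by simp [Skel, h]

/-- If `i ∈ Per_p` but the class of `j` mod `p` carries a different symbol,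
then a long window at `a` and `b` distinguishes. -/
theorem sep_aux {x : ℤ → A} (hT : IsToeplitz x) {p : ℕ} (hp : 0 < p) {i j : ℤ}
    (hi : i ∈ PerSet x p) (hne : Skel x p j ≠ Skel x p i) :
    ∃ N : ℕ, ∀ a b : ℤ, (p : ℤ) ∣ (a - b) - (j - i) →
      ¬ ∀ u : ℤ, -N ≤ u → u ≤ N → x (a + u) = x (b + u) := by
  have hex : ∃ n : ℤ, x (j + n * p) ≠ x i := by
    by_contra! hcon
    have h0 : x j = x i := by simpa using hcon 0
    have : j ∈ PerSet x p := fun k => by rw [hcon k, h0]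
    exact hne (by rw [Skel_some this, Skel_some hi, h0])
  obtain ⟨n, hn⟩ := hex
  set e := j + n * p with he
  obtain ⟨p', hp', hper⟩ := hT e
  refine ⟨p * p', fun a b hab hw => ?_⟩
  have hpz : (0:ℤ) < ((p * p' : ℕ) : ℤ) := by
    have : 0 < p * p' := Nat.mul_pos hp (by omega)
    exact_mod_cast this
  have hm := Int.emod_nonneg (e - a) hpz.ne'
  have hm2 := Int.emod_lt_of_pos (e - a) hpz
  have hd := Int.mul_ediv_add_emod (e - a) ((p * p' : ℕ) : ℤ)
  set r := (e - a) % ((p * p' : ℕ) : ℤ)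
  set d := (e - a) / ((p * p' : ℕ) : ℤ)
  have h1 := hw r (by omega) (by omega)
  have h2 : x (a + r) = x e := by
    rw [← hper (-d * p)]; congr 1; push_cast at hd; linarith
  obtain ⟨c, hc⟩ := hab
  have h3 : x (b + r) = x i := by
    rw [← hi (n - c - d * p')]; congr 1; push_cast at hd; linarith
  exact hn (by rw [← h2, h1, h3])

theorem essential_Al {x : ℤ → A} (hT : IsToeplitz x) {p : ℕ} (he : IsEssentialPeriod x p) :
    ∃ N, Al x p N := by
  have hp : 0 < p := by have := he.1; omega
  have hd : ∀ d : ℕ, ∃ N : ℕ, 0 < d → d < p → ∀ a b : ℤ, (p : ℤ) ∣ (a - b) - d →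
      ¬ ∀ u : ℤ, -N ≤ u → u ≤ N → x (a + u) = x (b + u) := by
    intro d
    by_cases h : 0 < d ∧ d < p
    · obtain ⟨i, hi⟩ := he.2 d h.1 h.2
      by_cases hper : i ∈ PerSet x p
      · obtain ⟨N, hN⟩ := sep_aux hT hp hper hi
        exact ⟨N, fun _ _ a b hab => hN a b (by rwa [add_sub_cancel_left])⟩
      · by_cases hper2 : i + d ∈ PerSet x p
        · obtain ⟨N, hN⟩ := sep_aux hT hp hper2 hi.symm
          refine ⟨N, fun _ _ a b hab hw => hN b a ?_ fun u h1 h2 => (hw u h1 h2).symm⟩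
          rw [show b - a - (i - (i + d)) = -(a - b - d) by ring]; exact dvd_neg.mpr hab
        · exact absurd (by rw [Skel_none hper, Skel_none hper2]) hi
    · exact ⟨0, fun h1 h2 => absurd ⟨h1, h2⟩ h⟩
  choose N hN using hd
  refine ⟨(Finset.range p).sup N, fun a b hw => ?_⟩
  have hpz : (0:ℤ) < p := by exact_mod_cast hp
  have hm := Int.emod_nonneg (a - b) hpz.ne'
  have hm2 := Int.emod_lt_of_pos (a - b) hpz
  by_contra hnd
  have hr : (a - b) % p ≠ 0 := fun h => hnd (Int.dvd_of_emod_eq_zero h)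
  have hle : N ((a - b) % p).toNat ≤ (Finset.range p).sup N :=
    Finset.le_sup (Finset.mem_range.mpr (by omega))
  refine hN ((a - b) % p).toNat (by omega) (by omega) a b ?_ fun u h1 h2 =>
    hw u (by omega) (by omega)
  rw [show ((((a - b) % p).toNat : ℕ) : ℤ) = (a - b) % p by omega]
  exact Int.dvd_self_sub_emod

theorem Al.of_dvd {x : ℤ → A} {p q N : ℕ} (h : Al x p N) (hq : q ∣ p) : Al x q N :=
  fun a b hw => (Int.natCast_dvd_natCast.mpr hq).trans (h a b hw)

theorem DividesScale.al [TopologicalSpace A] [DiscreteTopology A] {X : Set (ℤ → A)}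
    (hX : IsToeplitzSubshift X) {q : ℕ} (h : DividesScale X q) {x : ℤ → A} (hx : x ∈ X) :
    ∃ N, Al x q N := by
  obtain ⟨x0, P, hg, hP, n, hn⟩ := h
  obtain ⟨N, hN⟩ := essential_Al hg.1 (hP.2.1 n)
  exact ⟨N, (hN.of_dvd hn).transfer hX (generator_mem hg) hx⟩

/-- Reduction of a period to an essential one. -/
theorem exists_essential {x : ℤ → A} (hap : IsAperiodicPoint x) {p : ℕ} (hp : 0 < p)
    (hne : (PerSet x p).Nonempty) :
    ∃ d : ℕ, IsEssentialPeriod x d ∧ PerSet x p ⊆ PerSet x d ∧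
      ∀ q, q ∣ p → IsEssentialPeriod x q → q ∣ d := by
  classical
  have hex : ∃ d : ℕ, 0 < d ∧ ∀ i, Skel x p (i + d) = Skel x p i := by
    refine ⟨p, hp, fun i => ?_⟩
    by_cases h : i ∈ PerSet x p
    · have h2 := PerSet_add h 1
      rw [one_mul] at h2
      rw [Skel_some h, Skel_some h2]
      have := h 1
      rw [one_mul] at this; rw [this]
    · have h2 : i + p ∉ PerSet x p := fun h2 => h (by
        have := PerSet_add h2 (-1); simpa using this)
      rw [Skel_none h, Skel_none h2]
  set d := Nat.find hex with hd
  obtain ⟨hd0, hdp⟩ := Nat.find_spec hex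
  rw [← hd] at hd0 hdp
  have hstep : ∀ (k : ℤ) (i : ℤ), Skel x p (i + k * d) = Skel x p i := by
    intro k
    induction k using Int.induction_on with
    | zero => intro i; simp
    | succ k ih => intro i; rw [show i + ((k:ℤ) + 1) * d = (i + k * d) + d by ring, hdp, ih]
    | pred k ih =>
      intro i
      rw [← hdp, ← ih i]; congr 1; ring
  have hsub : PerSet x p ⊆ PerSet x d := by
    intro i hi k
    have h1 := hstep k i
    rw [Skel_some hi] at h1
    have h2 : i + k * d ∈ PerSet x p := by
      by_contra h; rw [Skel_none h] at h1; cases h1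
    rw [Skel_some h2] at h1
    exact Option.some.inj h1
  have hdle : d ∣ p := by
    -- `p` itself is a period of the skeleton
    by_contra hnd
    have hpp : ∀ i, Skel x p (i + (p % d : ℕ)) = Skel x p i := by
      intro i
      have e1 : Skel x p (i + p) = Skel x p i := by
        by_cases h : i ∈ PerSet x p
        · have h2 := PerSet_add h 1
          rw [one_mul] at h2
          rw [Skel_some h, Skel_some h2]
          have := h 1
          rw [one_mul] at this; rw [this]
        · have h2 : i + p ∉ PerSet x p := fun h2 => h (by
            have := PerSet_add h2 (-1); simpa using this)
          rw [Skel_none h, Skel_none h2]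
      rw [← e1, ← hstep (p / d : ℕ) (i + (p % d : ℕ))]
      congr 1
      have := Nat.div_add_mod p d
      have : (p : ℤ) = d * (p / d : ℕ) + (p % d : ℕ) := by exact_mod_cast this.symm
      rw [add_assoc]; congr 1; rw [this]; push_cast; ring_nf
    have hpos : 0 < p % d := Nat.pos_of_ne_zero fun h => hnd (Nat.dvd_of_mod_eq_zero h)
    exact Nat.find_min hex (Nat.mod_lt _ hd0) ⟨hpos, hpp⟩
  have hSk : ∀ i, Skel x d i = Skel x p i := by
    intro i
    by_cases h : i ∈ PerSet x p
    · rw [Skel_some h, Skel_some (hsub h)]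
    · rw [Skel_none h, Skel_none fun h2 => h (PerSet_mono hdle h2)]
  have hess : IsEssentialPeriod x d := by
    constructor
    · by_contra hle
      have hd1 : d = 1 := by omega
      obtain ⟨i, hi⟩ := hne
      have := hsub hi
      rw [hd1] at this
      have hc : ∀ j, x j = x i := fun j => by
        have h := this (j - i); rw [← h]; congr 1; push_cast; ring
      exact hap ⟨1, one_pos, fun j => by rw [hc, hc j]⟩
    · intro q hq0 hqd
      by_contra! hcon
      refine Nat.find_min hex hqd ⟨hq0, fun i => ?_⟩
      rw [← hSk, ← hSk, hcon]
  refine ⟨d, hess, hsub, fun q hq hqe => ?_⟩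
  -- the `q`-skeleton has period `d`
  by_contra hnd
  have hq0 : 0 < q := by have := hqe.1; omega
  have hk : ∀ (k : ℤ) (i : ℤ), i ∈ PerSet x q → i + k * d ∈ PerSet x q ∧ x (i + k * d) = x i := by
    intro k i hi
    have h1 : ∀ l : ℤ, x (i + k * d + l * q) = x i := by
      intro l
      have := hsub (PerSet_mono hq (PerSet_add hi l)) k
      rw [show i + k * d + l * q = i + l * q + k * d by ring, this, hi l]
    have h0 : x (i + k * d) = x i := by simpa using h1 0
    exact ⟨fun l => by rw [h1, h0], h0⟩
  have hpos : 0 < d % q := Nat.pos_of_ne_zero fun h => hnd (Nat.dvd_of_mod_eq_zero h)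
  obtain ⟨i, hi⟩ := hqe.2 (d % q) hpos (Nat.mod_lt _ hq0)
  have hdq : ((d % q : ℕ) : ℤ) = d - (d / q : ℕ) * q := by
    have : (d : ℤ) = q * (d / q : ℕ) + (d % q : ℕ) := by exact_mod_cast (Nat.div_add_mod d q).symm
    linarith [mul_comm (q:ℤ) ((d / q : ℕ) : ℤ)]
  rw [hdq] at hi
  have hf : ∀ j, j ∈ PerSet x q → Skel x q (j + (d - (d / q : ℕ) * q)) = Skel x q j := by
    intro j hj
    have h1 := hk 1 j hj
    rw [one_mul] at h1
    have h2 := PerSet_add h1.1 (-((d / q : ℕ) : ℤ))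
    have h3 := h1.1 (-((d / q : ℕ) : ℤ))
    rw [show j + (d - ((d / q : ℕ) : ℤ) * q) = j + d + -((d / q : ℕ) : ℤ) * q by ring,
      Skel_some h2, Skel_some hj, h3, h1.2]
  by_cases hper : i ∈ PerSet x q
  · exact hi (hf i hper)
  · by_cases hper2 : i + (d - (d / q : ℕ) * q) ∈ PerSet x q
    · apply hper
      have h1 := (hk (-1) _ hper2).1
      have h2 := PerSet_add h1 ((d / q : ℕ) : ℤ)
      rw [show i + (d - ((d / q : ℕ) : ℤ) * q) + -1 * d + ((d / q : ℕ) : ℤ) * q = i by ring] at h2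
      exact h2
    · exact hi (by rw [Skel_none hper, Skel_none hper2])

theorem exists_next {x : ℤ → A} (hT : IsToeplitz x) (hap : IsAperiodicPoint x) (p : ℕ)
    (hp : 0 < p) (n : ℕ) :
    ∃ d : ℕ, IsEssentialPeriod x d ∧ (IsEssentialPeriod x p → p ∣ d ∧ p < d) ∧
      ∀ i : ℤ, -n ≤ i → i ≤ n → i ∈ PerSet x d := by
  obtain ⟨r, hr, hr2⟩ := exists_common_period hT (-(n + p : ℕ)) (2 * (n + p) + 1)
  have hr3 : ∀ i : ℤ, -(n + p : ℕ) ≤ i → i ≤ (n + p : ℕ) → i ∈ PerSet x (p * r) := by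
    intro i h1 h2
    have := hr2 (i + (n + p : ℕ)).toNat (by omega)
    refine PerSet_mono (Dvd.intro_left _ rfl) (p := r) ?_
    rw [show (((i + (n + p : ℕ)).toNat : ℕ) : ℤ) = i + (n + p : ℕ) by omega] at this
    rwa [show -((n + p : ℕ) : ℤ) + (i + (n + p : ℕ)) = i by ring] at this
  obtain ⟨d, hd, hsub, hdiv⟩ := exists_essential hap (p := p * r) (Nat.mul_pos hp hr)
    ⟨0, hr3 0 (by omega) (by omega)⟩
  refine ⟨d, hd, fun hpe => ?_, fun i h1 h2 => hsub (hr3 i (by omega) (by omega))⟩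
  have hdv := hdiv p (Dvd.intro _ rfl) hpe
  refine ⟨hdv, lt_of_le_of_ne (Nat.le_of_dvd (by have := hd.1; omega) hdv) ?_⟩
  rintro rfl
  apply hap
  refine ⟨p, hp, fun i => ?_⟩
  have hpz : (0:ℤ) < p := by exact_mod_cast hp
  have hm := Int.emod_nonneg i hpz.ne'
  have hm2 := Int.emod_lt_of_pos i hpz
  have hdm := Int.mul_ediv_add_emod i p
  have h1 : i % p ∈ PerSet x p := hsub (hr3 _ (by omega) (by omega))
  have h2 := h1 (i / p)
  have h3 := h1 (i / p + 1)
  rw [show i % p + i / p * p = i by linarith [mul_comm (i / (p:ℤ)) (p:ℤ)]] at h2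
  rw [show i % p + (i / p + 1) * p = i + p by linarith [mul_comm (i / (p:ℤ)) (p:ℤ)]] at h3
  rw [h2, h3]

theorem exists_period_structure {x : ℤ → A} (hT : IsToeplitz x) (hap : IsAperiodicPoint x) :
    ∃ P, IsPeriodStructure x P := by
  choose f hf1 hf2 hf3 using fun (p : {p : ℕ // 0 < p}) (n : ℕ) =>
    exists_next hT hap p.1 p.2 n
  let g : ℕ → {p : ℕ // 0 < p} := fun n =>
    Nat.rec ⟨f ⟨1, one_pos⟩ 0, by have := (hf1 ⟨1, one_pos⟩ 0).1; omega⟩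
      (fun n p => ⟨f p n, by have := (hf1 p n).1; omega⟩) n
  have hg : ∀ n, (g (n+1)).1 = f (g n) n := fun n => rfl
  have hess : ∀ n, IsEssentialPeriod x (g n).1 := by
    intro n
    cases n with
    | zero => exact hf1 _ _
    | succ n => exact hf1 _ _
  refine ⟨fun n => (g n).1, strictMono_nat_of_lt_succ fun n => ?_, hess, fun n => ?_, fun i => ?_⟩
  · exact (hf2 (g n) n (hess n)).2
  · exact (hf2 (g n) n (hess n)).1
  · exact ⟨i.natAbs + 1, hf3 (g i.natAbs) i.natAbs i (by omega) (by omega)⟩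

theorem dividesScale_of_Al [TopologicalSpace A] [DiscreteTopology A] {X : Set (ℤ → A)}
    (hX : IsToeplitzSubshift X) (hap : ∀ x ∈ X, IsAperiodicPoint x)
    {x : ℤ → A} (hx : x ∈ X) {q N : ℕ} (h : Al x q N) : DividesScale X q := by
  obtain ⟨x0, hg⟩ := id hX
  obtain ⟨P, hP⟩ := exists_period_structure hg.1 (hap x0 (generator_mem hg))
  refine ⟨x0, P, hg, hP, ?_⟩
  have h0 := h.transfer hX hx (generator_mem hg)
  have hdv : ∀ m n, m ≤ n → P m ∣ P n := fun m n hmn =>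
    Nat.le_induction dvd_rfl (fun k _ ih => ih.trans (hP.2.2.1 k)) n hmn
  have hw : ∀ M : ℕ, ∃ n, ∀ m : ℕ, m < M → (-N + m : ℤ) ∈ PerSet x0 (P n) := by
    intro M
    induction M with
    | zero => exact ⟨0, fun m hm => absurd hm (Nat.not_lt_zero _)⟩
    | succ M ih =>
      obtain ⟨n, hn⟩ := ih
      obtain ⟨n', hn'⟩ := hP.2.2.2 (-N + M)
      refine ⟨max n n', fun m hm => ?_⟩
      rcases Nat.lt_succ_iff_lt_or_eq.mp hm with h1 | rfl
      · exact PerSet_mono (hdv _ _ (le_max_left _ _)) (hn m h1)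
      · exact PerSet_mono (hdv _ _ (le_max_right _ _)) hn'
  obtain ⟨n, hn⟩ := hw (2 * N + 1)
  refine ⟨n, ?_⟩
  have := h0 (P n) 0 (fun i h1 h2 => by
    have := hn (i + N).toNat (by omega)
    rw [show (-N + (((i + N).toNat : ℕ) : ℤ)) = i by omega] at this
    have := this 1
    rw [show (P n : ℤ) + i = i + 1 * P n by ring, this, zero_add])
  rw [sub_zero] at this
  exact_mod_cast this

/-! ### Words -/

theorem factorAt_def (x : ℤ → A) (i : ℤ) (n : ℕ) :
    factorAt x i n = (List.range n).map (fun j : ℕ => x (i + (j : ℤ))) := by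
  unfold factorAt
  have : ∀ l : List ℕ, (l >>= fun a => pure (a : ℤ) : List ℤ) = l.map (fun a : ℕ => (a : ℤ)) := by
    intro l
    induction l with
    | nil => rfl
    | cons a l ih => simpa using ih
  rw [this, List.map_map]; rfl

theorem factorAt_length (x : ℤ → A) (i : ℤ) (n : ℕ) : (factorAt x i n).length = n := by
  simp [factorAt_def]

theorem factorAt_get {x : ℤ → A} {i : ℤ} {n m : ℕ} (h : m < n) :
    (factorAt x i n)[m]? = some (x (i + m)) := by
  simp [factorAt_def, h]

theorem factorAt_congr {x y : ℤ → A} {i j : ℤ} {n : ℕ} :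
    factorAt x i n = factorAt y j n ↔ ∀ m : ℕ, m < n → x (i + m) = y (j + m) := by
  constructor
  · intro h m hm
    have := congrArg (fun l => l[m]?) h
    simp only [factorAt_get hm] at this
    exact Option.some.inj this
  · intro h
    rw [factorAt_def, factorAt_def]
    apply List.map_congr_left
    intro m hm
    exact h m (List.mem_range.mp hm)

theorem factorAt_append (x : ℤ → A) (i : ℤ) (n m : ℕ) :
    factorAt x i (n + m) = factorAt x i n ++ factorAt x (i + n) m := by
  rw [factorAt_def, factorAt_def, factorAt_def]
  rw [List.range_add, List.map_append, List.map_map]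
  congr 1
  apply List.map_congr_left
  intro j _
  simp only [Function.comp]
  congr 1; push_cast; ring

theorem infix_get {V : List A} {y : ℤ → A} {i : ℤ} {m : ℕ} (h : factorAt y i m <:+: V) :
    ∃ s : ℕ, s + m ≤ V.length ∧ ∀ j : ℕ, j < m → V[s + j]? = some (y (i + j)) := by
  obtain ⟨a, b, rfl⟩ := h
  refine ⟨a.length, by simp [factorAt_length], fun j hj => ?_⟩
  rw [List.append_assoc, List.getElem?_append_right (by omega),
    List.getElem?_append_left (by rw [factorAt_length]; omega), Nat.add_sub_cancel_left,
    factorAt_get hj]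

theorem infix_of_get {V : List A} {y : ℤ → A} {i : ℤ} {m s : ℕ}
    (h : ∀ j : ℕ, j < m → V[s + j]? = some (y (i + j))) : factorAt y i m <:+: V := by
  have : factorAt y i m = (V.drop s).take m := by
    apply List.ext_getElem?
    intro j
    by_cases hj : j < m
    · rw [factorAt_get hj, List.getElem?_take_of_lt hj, List.getElem?_drop, h j hj]
    · rw [List.getElem?_eq_none (by rw [factorAt_length]; omega),
        List.getElem?_eq_none (by simp; omega)]
  rw [this]
  exact (List.take_prefix _ _).isInfix.trans (List.drop_suffix _ _).isInfix

theorem flatMap_length {f : B → List C} {l : ℕ} (hf : ∀ b, (f b).length = l) (W : List B) :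
    (W.flatMap f).length = W.length * l := by
  induction W with
  | nil => simp
  | cons a W ih => simp [ih, hf, Nat.succ_mul, Nat.add_comm]

theorem flatMap_get {f : B → List C} {l : ℕ} (hf : ∀ b, (f b).length = l) (W : List B)
    {g m : ℕ} {b : B} (hg : W[g]? = some b) (hm : m < l) :
    (W.flatMap f)[g * l + m]? = (f b)[m]? := by
  induction W generalizing g with
  | nil => simp at hg
  | cons a W ih =>
    rw [List.flatMap_cons]
    cases g with
    | zero =>
      simp at hg
      subst hg
      rw [List.getElem?_append_left (by rw [hf]; omega)]; simp
    | succ g =>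
      simp at hg
      rw [List.getElem?_append_right (by rw [hf, Nat.succ_mul]; omega), hf, ← ih hg]
      congr 1
      rw [Nat.succ_mul]; omega

/-- Concatenating consecutive factors. -/
theorem flatMap_factorAt {y : ℤ → B} {z : ℤ → C} {f : B → List C} {E : ℤ} {L : ℕ}
    (h : ∀ k : ℤ, f (y k) = factorAt z (E + k * L) L) (k : ℤ) (n : ℕ) :
    (factorAt y k n).flatMap f = factorAt z (E + k * L) (n * L) := by
  induction n with
  | zero => simp [factorAt_def]
  | succ n ih =>
    rw [factorAt_append, List.flatMap_append, ih, Nat.succ_mul, factorAt_append]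
    congr 1
    simp only [factorAt_def y, List.range_one, List.map_cons, List.map_nil, List.flatMap_cons,
      List.flatMap_nil, List.append_nil]
    rw [h]
    rw [factorAt_congr]
    intro m _
    congr 1; push_cast; ring

/-! ### Cuts -/

theorem mem_cutWords (x : ℤ → A) (q t : ℕ) (k : ℤ) :
    factorAt x (t + k * q) q ∈ cutWords x q t := ⟨k, rfl⟩

theorem cut_fun {x : ℤ → A} {q t m : ℕ} {u v : List A} (hc : cutWords x q t = {u, v})
    (hp : CommonPrefixLongerThan u v m) (hs : CommonSuffixLongerThan u v m) :
    m + 1 ≤ q ∧ ∀ (k i : ℤ), -(m + 1) ≤ i → i < m + 1 → x (t + k * q + i) = x (t + i) := by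
  have hlen : u.length = q ∧ v.length = q := by
    have hu : u ∈ cutWords x q t := by rw [hc]; simp
    have hv : v ∈ cutWords x q t := by rw [hc]; simp
    obtain ⟨k, rfl⟩ := hu
    obtain ⟨k', rfl⟩ := hv
    exact ⟨factorAt_length _ _ _, factorAt_length _ _ _⟩
  have hmq : m + 1 ≤ q := by have := hp.1; omega
  have hmem : ∀ k : ℤ, factorAt x (t + k * q) q = u ∨ factorAt x (t + k * q) q = v := by
    intro k
    have := mem_cutWords x q t k
    rw [hc] at this
    simpa using this
  have hpre : ∀ i : ℕ, i < m + 1 → u[i]? = v[i]? := by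
    intro i hi
    have := congrArg (fun l => l[i]?) hp.2.2
    simpa [List.getElem?_take_of_lt hi] using this
  have hsuf : ∀ i : ℕ, i < m + 1 → u[q - 1 - i]? = v[q - 1 - i]? := by
    intro i hi
    have := congrArg (fun l => l[i]?) hs.2.2
    simp only [List.getElem?_take_of_lt hi] at this
    rw [List.getElem?_reverse (by omega), List.getElem?_reverse (by omega), hlen.1, hlen.2] at this
    exact this
  have hP : ∀ (k : ℤ) (i : ℕ), i < m + 1 → some (x (t + k * q + i)) = u[i]? := by
    intro k i hi
    rw [← factorAt_get (n := q) (by omega)]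
    rcases hmem k with h | h <;> rw [h]
    exact (hpre i hi).symm
  have hS : ∀ (k : ℤ) (i : ℕ), i < m + 1 →
      some (x (t + k * q + ((q - 1 - i : ℕ) : ℤ))) = u[q - 1 - i]? := by
    intro k i hi
    rw [← factorAt_get (n := q) (by omega)]
    rcases hmem k with h | h <;> rw [h]
    exact (hsuf i hi).symm
  refine ⟨hmq, fun k i h1 h2 => ?_⟩
  by_cases hi : 0 ≤ i
  · have a := hP k i.toNat (by omega)
    have b := hP 0 i.toNat (by omega)
    rw [← b, show ((i.toNat : ℕ) : ℤ) = i by omega] at a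
    simpa using a
  · have a := hS (k - 1) (-i - 1).toNat (by omega)
    have b := hS (-1) (-i - 1).toNat (by omega)
    rw [← b] at a
    have e : ((q - 1 - (-i - 1).toNat : ℕ) : ℤ) = q + i := by omega
    rw [e] at a
    have a' := Option.some.inj a
    rw [show (t:ℤ) + (k - 1) * q + (q + i) = t + k * q + i by ring,
      show (t:ℤ) + (-1) * q + (q + i) = t + i by ring] at a'
    exact a'

theorem next_cut [TopologicalSpace A] {X : Set (ℤ → A)} {x : ℤ → A} (hG : GoodCuts X x)
    (q : ℕ) (hq : 0 < q) (hd : DividesScale X q) (t : ℤ) :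
    ∃ (ℓ : ℕ) (e : ℤ), 1 < ℓ ∧ DividesScale X (q * ℓ) ∧
      (∀ k i : ℤ, -q ≤ i → i < q →
        x (t + e * q + k * (q * ℓ : ℕ) + i) = x (t + e * q + i)) ∧
      ∃ c : ℤ → Bool, ∀ k k' : ℤ, c k = c k' → ∀ i : ℕ, i < q * ℓ →
        x (t + e * q + k * (q * ℓ : ℕ) + i) = x (t + e * q + k' * (q * ℓ : ℕ) + i) := by
  classical
  obtain ⟨q', t1, -, ⟨ℓ, rfl⟩, hd', u, v, huv, hc, hp, hs⟩ := hG q hq hd (2 * q)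
  obtain ⟨hle, hfun⟩ := cut_fun hc hp hs
  have hqz : (0:ℤ) < q := by exact_mod_cast hq
  have hm := Int.emod_nonneg (t - t1) hqz.ne'
  have hm2 := Int.emod_lt_of_pos (t - t1) hqz
  have hdm := Int.mul_ediv_add_emod (t - t1) q
  set d := (t - t1) % q with hdd
  have ht' : t + (-((t - t1) / q)) * q = t1 + d := by
    linarith [mul_comm ((t - t1) / (q:ℤ)) (q:ℤ)]
  refine ⟨ℓ, -((t - t1) / q), ?_, hd', ?_, ?_⟩
  · by_contra h
    have : ℓ ≤ 1 := by omega
    have := Nat.mul_le_mul_left q this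
    omega
  · intro k i h1 h2
    rw [ht', show (t1:ℤ) + d + k * (q * ℓ : ℕ) + i = t1 + k * (q * ℓ : ℕ) + (d + i) by ring,
      hfun k (d + i) (by push_cast; omega) (by push_cast; omega)]
    congr 1; ring
  · refine ⟨fun k => decide (factorAt x (t1 + k * (q * ℓ : ℕ)) (q * ℓ) = u), fun k k' hk i hi => ?_⟩
    have hmem : ∀ k : ℤ, factorAt x (t1 + k * (q * ℓ : ℕ)) (q * ℓ) = u ∨
        factorAt x (t1 + k * (q * ℓ : ℕ)) (q * ℓ) = v := by
      intro k
      have := mem_cutWords x (q * ℓ) t1 k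
      rw [hc] at this
      simpa using this
    have hEq : factorAt x (t1 + k * (q * ℓ : ℕ)) (q * ℓ) =
        factorAt x (t1 + k' * (q * ℓ : ℕ)) (q * ℓ) := by
      have hiff := decide_eq_decide.mp hk
      rcases hmem k with h | h
      · rw [h, hiff.mp h]
      · rcases hmem k' with h' | h'
        · rw [hiff.mpr h', h']
        · rw [h, h']
    rw [factorAt_congr] at hEq
    rw [ht']
    by_cases hid : d.toNat + i < q * ℓ
    · have := hEq _ hid
      push_cast at this
      rw [show ((d.toNat : ℕ) : ℤ) = d by omega] at this
      rw [show (t1:ℤ) + d + k * (q * ℓ : ℕ) + i = t1 + k * (q * ℓ) + (d + i) by push_cast; ring,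
        this]
      congr 1; push_cast; ring
    · have hcast : ((q * ℓ : ℕ) : ℤ) ≤ d + i := by omega
      have hcast2 : (i : ℤ) < ((q * ℓ : ℕ) : ℤ) := by exact_mod_cast hi
      have a := hfun (k + 1) (d + i - (q * ℓ : ℕ)) (by omega) (by push_cast at *; omega)
      have b := hfun (k' + 1) (d + i - (q * ℓ : ℕ)) (by omega) (by push_cast at *; omega)
      rw [← b] at a
      rw [show (t1:ℤ) + d + k * (q * ℓ : ℕ) + i
          = t1 + (k + 1) * (q * ℓ : ℕ) + (d + i - (q * ℓ : ℕ)) by ring, a]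
      congr 1; ring

/-! ### The directive sequence attached to a sequence of cuts -/

/-- Equality of blocks. -/
def blkSetoid (x : ℤ → A) (q : ℕ) (t : ℤ) : Setoid ℤ where
  r k k' := ∀ i : ℕ, i < q → x (t + k * q + i) = x (t + k' * q + i)
  iseqv := ⟨fun _ _ _ => rfl, fun h i hi => (h i hi).symm,
    fun h h' i hi => (h i hi).trans (h' i hi)⟩

/-- The alphabet of level `n`. -/
def Blk (x : ℤ → A) (Q : ℕ → ℕ) (T : ℕ → ℤ) (n : ℕ) : Type :=
  Quotient (blkSetoid x (Q n) (T n))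

/-- The point of level `n`. -/
def lev (x : ℤ → A) (Q : ℕ → ℕ) (T : ℕ → ℤ) (n : ℕ) (k : ℤ) : Blk x Q T n :=
  Quotient.mk (blkSetoid x (Q n) (T n)) k

/-- The morphisms. -/
noncomputable def sig (x : ℤ → A) (Q : ℕ → ℕ) (T : ℕ → ℤ) (ℓ : ℕ → ℕ) (e : ℕ → ℤ) (n : ℕ)
    (b : Blk x Q T (n+1)) : List (Blk x Q T n) :=
  factorAt (lev x Q T n) (e n + (Quotient.out b) * ℓ n) (ℓ n)

theorem lev_eq {x : ℤ → A} {Q : ℕ → ℕ} {T : ℕ → ℤ} {n : ℕ} {k k' : ℤ} :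
    lev x Q T n k = lev x Q T n k' ↔
      ∀ i : ℕ, i < Q n → x (T n + k * Q n + i) = x (T n + k' * Q n + i) := by
  constructor
  · intro h; exact Quotient.exact h
  · intro h; exact Quotient.sound (s := blkSetoid x (Q n) (T n)) h

theorem lev_surj {x : ℤ → A} {Q : ℕ → ℕ} {T : ℕ → ℤ} {n : ℕ} (b : Blk x Q T n) :
    ∃ k, lev x Q T n k = b := ⟨Quotient.out b, Quotient.out_eq b⟩

/-- the relation between blocks of consecutive levels -/
theorem lev_succ {x : ℤ → A} {Q : ℕ → ℕ} {T : ℕ → ℤ} {ℓ : ℕ → ℕ} {e : ℕ → ℤ}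
    (hQ0 : ∀ n, 0 < Q n)
    (hQ : ∀ n, Q (n+1) = Q n * ℓ n) (hT : ∀ n, T (n+1) = T n + e n * Q n) {n : ℕ} {k k' : ℤ} :
    lev x Q T (n+1) k = lev x Q T (n+1) k' ↔
      factorAt (lev x Q T n) (e n + k * ℓ n) (ℓ n) =
        factorAt (lev x Q T n) (e n + k' * ℓ n) (ℓ n) := by
  rw [factorAt_congr, lev_eq, hQ, hT]
  constructor
  · intro h j hj
    rw [lev_eq]
    intro i hi
    have := h (j * Q n + i) (by
      have : (j + 1) * Q n ≤ ℓ n * Q n := Nat.mul_le_mul_right _ hj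
      rw [Nat.succ_mul] at this; rw [Nat.mul_comm (Q n)]; omega)
    push_cast at this
    convert this using 2 <;> ring
  · intro h i hi
    have h1 := h (i / Q n) (Nat.div_lt_of_lt_mul hi)
    rw [lev_eq] at h1
    have h2 := h1 (i % Q n) (Nat.mod_lt _ (hQ0 n))
    have h3 : (i : ℤ) = Q n * (i / Q n : ℕ) + (i % Q n : ℕ) := by
      exact_mod_cast (Nat.div_add_mod i (Q n)).symm
    generalize (i / Q n : ℕ) = a at *
    generalize (i % Q n : ℕ) = b at *
    rw [h3]
    push_cast
    convert h2 using 2 <;> ring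

theorem sig_lev {x : ℤ → A} {Q : ℕ → ℕ} {T : ℕ → ℤ} {ℓ : ℕ → ℕ} {e : ℕ → ℤ}
    (hQ0 : ∀ n, 0 < Q n)
    (hQ : ∀ n, Q (n+1) = Q n * ℓ n) (hT : ∀ n, T (n+1) = T n + e n * Q n) (n : ℕ) (k : ℤ) :
    sig x Q T ℓ e n (lev x Q T (n+1) k) = factorAt (lev x Q T n) (e n + k * ℓ n) (ℓ n) := by
  unfold sig
  rw [← lev_succ hQ0 hQ hT]
  exact Quotient.out_eq _

theorem sadic_lev {x : ℤ → A} {Q : ℕ → ℕ} {T : ℕ → ℤ} {ℓ : ℕ → ℕ} {e : ℕ → ℤ}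
    (hQ0 : ∀ n, 0 < Q n)
    (hQ : ∀ n, Q (n+1) = Q n * ℓ n) (hT : ∀ n, T (n+1) = T n + e n * Q n) (n K : ℕ) :
    ∃ (E : ℤ) (L : ℕ), Q (n + K) = Q n * L ∧
      ∀ k : ℤ, sadicWordAux (sig x Q T ℓ e) n K (lev x Q T (n + K) k) =
        factorAt (lev x Q T n) (E + k * L) L := by
  induction K with
  | zero =>
    refine ⟨0, 1, by simp, fun k => ?_⟩
    simp [sadicWordAux, factorAt_def]
  | succ K ih =>
    obtain ⟨E, L, h1, h2⟩ := ih
    refine ⟨E + e (n + K) * L, ℓ (n + K) * L, ?_, fun k => ?_⟩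
    · rw [← add_assoc, hQ, h1]; ring
    · have h3 : sadicWordAux (sig x Q T ℓ e) n (K + 1) (lev x Q T (n + (K + 1)) k) =
          (sig x Q T ℓ e (n + K) (lev x Q T (n + K + 1) k)).flatMap
            (sadicWordAux (sig x Q T ℓ e) n K) := rfl
      rw [h3, sig_lev hQ0 hQ hT, flatMap_factorAt h2]
      rw [factorAt_congr]
      intro m _
      congr 1; push_cast; ring

theorem pow_le_Q {Q ℓ : ℕ → ℕ} (hQ0 : ∀ n, 0 < Q n)
    (hQ : ∀ n, Q (n+1) = Q n * ℓ n) (hl : ∀ n, 1 < ℓ n) (n K : ℕ) :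
    K < Q (n + K) := by
  induction K with
  | zero => exact hQ0 _
  | succ K ih =>
    rw [← add_assoc, hQ]
    have := hl (n + K)
    nlinarith

/-- The converse direction: good cuts give an `S`-adic representation of rank two. -/
theorem strong_of_goodCuts [Fintype A] [TopologicalSpace A] [DiscreteTopology A]
    {X : Set (ℤ → A)} (hX : IsToeplitzSubshift X)
    (hap : ∀ x ∈ X, IsAperiodicPoint x) {x : ℤ → A} (hx : x ∈ X) (hG : GoodCuts X x) :
    IsStrongToeplitzOfRank X 2 := by
  classical
  have hd1 : DividesScale X 1 := dividesScale_of_Al hX hap hx (N := 0)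
    (fun a b _ => by simp)
  choose fl fe hf1 hf2 hf3 fc hf4 using
    fun s : {s : ℕ × ℤ // 0 < s.1 ∧ DividesScale X s.1} =>
      next_cut hG s.1.1 s.2.1 s.2.2 s.1.2
  let g : ℕ → {s : ℕ × ℤ // 0 < s.1 ∧ DividesScale X s.1} := fun n =>
    Nat.rec ⟨(1, 0), one_pos, hd1⟩ (fun _ s =>
      ⟨(s.1.1 * fl s, s.1.2 + fe s * s.1.1), Nat.mul_pos s.2.1 (by have := hf1 s; omega), hf2 s⟩) n
  let Q : ℕ → ℕ := fun n => (g n).1.1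
  let T : ℕ → ℤ := fun n => (g n).1.2
  let ℓ : ℕ → ℕ := fun n => fl (g n)
  let e : ℕ → ℤ := fun n => fe (g n)
  have hQ00 : Q 0 = 1 := rfl
  have hT00 : T 0 = 0 := rfl
  have hQ0 : ∀ n, 0 < Q n := fun n => (g n).2.1
  have hD : ∀ n, DividesScale X (Q n) := fun n => (g n).2.2
  have hQ : ∀ n, Q (n+1) = Q n * ℓ n := fun n => rfl
  have hT : ∀ n, T (n+1) = T n + e n * Q n := fun n => rfl
  have hl : ∀ n, 1 < ℓ n := fun n => hf1 (g n)
  have hprop : ∀ n, ∀ k i : ℤ, -(Q n : ℤ) ≤ i → i < Q n →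
      x (T (n+1) + k * Q (n+1) + i) = x (T (n+1) + i) := fun n => hf3 (g n)
  have htwo : ∀ n, ∃ c : ℤ → Bool, ∀ k k' : ℤ, c k = c k' → lev x Q T (n+1) k = lev x Q T (n+1) k' :=
    fun n => ⟨fc (g n), fun k k' h => lev_eq.mpr (hf4 (g n) k k' h)⟩
  clear_value Q T ℓ e
  -- finiteness of the alphabets
  have hfin : ∀ n, Finite (Blk x Q T n) := by
    intro n
    let r : Blk x Q T n → (Fin (Q n) → A) := fun b i => x (T n + (Quotient.out b) * Q n + (i : ℕ))
    apply Finite.of_injective r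
    intro b b' h
    rw [← Quotient.out_eq b, ← Quotient.out_eq b']
    exact Quotient.sound (s := blkSetoid x (Q n) (T n)) fun i hi => congrFun h ⟨i, hi⟩
  set σ := sig x Q T ℓ e with hσ
  have hsl : ∀ n k, σ n (lev x Q T (n+1) k) = factorAt (lev x Q T n) (e n + k * ℓ n) (ℓ n) :=
    sig_lev hQ0 hQ hT
  have hslen : ∀ n b, (σ n b).length = ℓ n := fun n b => factorAt_length _ _ _
  -- factors of points of the level are factors of `lev`
  have hlevfac : ∀ n, ∀ y ∈ XLevel σ n, ∀ (i : ℤ) (m : ℕ), ∃ s : ℤ, ∀ j : ℕ, j < m →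
      y (i + j) = lev x Q T n (s + j) := by
    intro n y hy i m
    obtain ⟨K, hK, a, ha⟩ := hy i m
    obtain ⟨k, rfl⟩ := lev_surj a
    obtain ⟨E, L, -, h2⟩ := sadic_lev (x := x) hQ0 hQ hT n K
    rw [h2] at ha
    obtain ⟨s, hs1, hs2⟩ := infix_get ha
    rw [factorAt_length] at hs1
    refine ⟨E + k * L + s, fun j hj => ?_⟩
    have := hs2 j hj
    rw [factorAt_get (by omega)] at this
    rw [← Option.some.inj this]; congr 1; push_cast; ring
  refine ⟨Blk x Q T, fun n => @Fintype.ofFinite _ (hfin n), σ, ?_, ?_, ?_, ?_, ?_, ?_, ?_⟩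
  · -- non erasing
    intro n a h
    have := hslen n a
    rw [h] at this
    have := hl n
    simp at *; omega
  · intro n a b; rw [hslen, hslen]
  · -- primitive
    intro n
    obtain ⟨N, hN⟩ := (hD n).al hX hx
    have hrec : ∀ b : Blk x Q T n, ∃ L : ℕ, ∀ s : ℤ, ∃ k : ℤ, s ≤ T n + k * Q n ∧
        T n + k * Q n ≤ s + L ∧ lev x Q T n k = b := by
      intro b
      obtain ⟨k0, rfl⟩ := lev_surj b
      obtain ⟨L, hL⟩ := unif_rec_al hX hx hN (T n + k0 * Q n) (Q n)
      refine ⟨L, fun s => ?_⟩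
      obtain ⟨s', h1, h2, ⟨c, hc⟩, h4⟩ := hL s
      have hs' : s' = T n + (k0 + c) * Q n := by linarith [mul_comm c (Q n : ℤ)]
      rw [hs'] at h1 h2 h4
      exact ⟨k0 + c, h1, h2, lev_eq.mpr h4⟩
    choose L hL using hrec
    haveI := hfin n
    haveI := Fintype.ofFinite (Blk x Q T n)
    obtain ⟨M, hM⟩ : ∃ M, ∀ b, L b ≤ M :=
      ⟨Finset.univ.sup L, fun b => Finset.le_sup (Finset.mem_univ b)⟩
    refine ⟨M + 1, Nat.succ_pos _, fun a b => ?_⟩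
    obtain ⟨k, rfl⟩ := lev_surj a
    obtain ⟨E, Λ, h1, h2⟩ := sadic_lev (x := x) hQ0 hQ hT n (M + 1)
    have h3 := pow_le_Q hQ0 hQ hl n (M + 1)
    rw [h1] at h3
    obtain ⟨k', h4, h5, rfl⟩ := hL b (T n + (E + k * Λ) * Q n)
    have h6 := hM (lev x Q T n k')
    have hq : (0:ℤ) < Q n := by exact_mod_cast hQ0 n
    have h7 : E + k * Λ ≤ k' := by nlinarith
    have h8 : k' < E + k * Λ + Λ := by
      have h3' : ((M + 1 : ℕ) : ℤ) < Q n * Λ := by exact_mod_cast h3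
      have h6' : (L (lev x Q T n k') : ℤ) ≤ M := by exact_mod_cast h6
      push_cast at h3'
      nlinarith
    rw [hσ, h2]
    rw [List.mem_iff_getElem?]
    refine ⟨(k' - (E + k * Λ)).toNat, ?_⟩
    rw [factorAt_get (by omega)]
    congr 2; omega
  · -- proper
    intro n
    refine ⟨lev x Q T n (e n), lev x Q T n (e n - 1), fun a => ?_⟩
    obtain ⟨k, rfl⟩ := lev_surj a
    rw [hsl]
    have hlpos := hl n
    constructor
    · rw [List.head?_eq_getElem?, factorAt_get (by omega)]
      congr 1
      rw [lev_eq]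
      intro i hi
      have := hprop n k i (by omega) (by omega)
      rw [hT, hQ] at this
      convert this using 2
      push_cast; ring
    · rw [List.getLast?_eq_getElem?, factorAt_length, factorAt_get (by omega)]
      congr 1
      rw [lev_eq]
      intro i hi
      have a := hprop n (k + 1) (i - Q n) (by omega) (by omega)
      rw [hT, hQ] at a
      convert a using 2
      · rw [show ((ℓ n - 1 : ℕ) : ℤ) = ℓ n - 1 by omega]; push_cast; ring
      · ring
  · -- recognizable
    intro n w y y' k k' hy hy'
    obtain ⟨N, hN⟩ := (hD (n+1)).al hX hx
    have hc : ∀ (y : ℤ → Blk x Q T (n+1)) (k : ℕ), IsCenteredRep (σ n) (XLevel σ (n+1)) w y k →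
        k < ℓ n ∧ ∀ (j : ℤ) (m : ℕ), m < ℓ n → (σ n (y j))[m]? = some (w (j * ℓ n + m - k)) := by
      rintro y k ⟨-, h2, c, hc0, hc1, hc2⟩
      rw [hslen] at h2
      refine ⟨h2, ?_⟩
      have hcj : ∀ j : ℤ, c j = j * ℓ n := by
        intro j
        induction j using Int.induction_on with
        | zero => simpa using hc0
        | succ j ih => rw [hc1, ih, hslen]; ring
        | pred j ih =>
          have := hc1 (-j - 1)
          rw [hslen, sub_add_cancel, ih] at this
          linarith
      intro j m hm
      have := hc2 j ⟨m, by rw [hslen]; exact hm⟩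
      rw [hcj] at this
      have this' : w (j * ℓ n + m - k) = _ := this
      rw [this']
      simp
    obtain ⟨hk, hr⟩ := hc y k hy
    obtain ⟨hk', hr'⟩ := hc y' k' hy'
    have hlz : (0:ℤ) < ℓ n := by have := hl n; omega
    -- the window in `lev`
    have hwin : ∀ (y : ℤ → Blk x Q T (n+1)) (k : ℕ), y ∈ XLevel σ (n+1) → k < ℓ n →
        (∀ (j : ℤ) (m : ℕ), m < ℓ n → (σ n (y j))[m]? = some (w (j * ℓ n + m - k))) →
        ∃ s : ℤ, ∀ i : ℤ, -(N + 1 : ℤ) ≤ i → i ≤ N + 1 →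
          w i = lev x Q T n (e n + s * ℓ n + k + i) := by
      intro y k hy hk hr
      obtain ⟨s, hs⟩ := hlevfac (n+1) y hy (-(N + 2 : ℕ)) (2 * (N + 2) + 1)
      refine ⟨s + (N + 2), fun i h1 h2 => ?_⟩
      have hm := Int.emod_nonneg (i + k) hlz.ne'
      have hm2 := Int.emod_lt_of_pos (i + k) hlz
      have hdm := Int.mul_ediv_add_emod (i + k) (ℓ n)
      set d := (i + k) / (ℓ n : ℤ) with hd
      set r := (i + k) % (ℓ n : ℤ) with hr0
      have hd1 : -(N + 1 : ℤ) ≤ d := by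
        by_contra hcon
        have : d ≤ -(N + 1 : ℤ) - 1 := by omega
        nlinarith
      have hd2 : d ≤ N + 2 := by
        by_contra hcon
        have : (N + 2 : ℤ) + 1 ≤ d := by omega
        have hl2 : (2:ℤ) ≤ ℓ n := by have := hl n; omega
        have : (ℓ n : ℤ) * (N + 3) ≤ ℓ n * d := by nlinarith
        nlinarith
      have h3 := hs (d + (N + 2)).toNat (by omega)
      rw [show (((d + (N + 2)).toNat : ℕ) : ℤ) = d + (N + 2) by omega] at h3
      have h4 := hr d r.toNat (by omega)
      rw [show d = -((N + 2 : ℕ) : ℤ) + (d + (N + 2)) by push_cast; ring, h3, hsl,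
        factorAt_get (by omega)] at h4
      have h5 := Option.some.inj h4
      rw [show ((r.toNat : ℕ) : ℤ) = r by omega] at h5
      rw [show (-((N + 2 : ℕ) : ℤ) + (d + (N + 2))) * ℓ n + r - k = i by push_cast; linarith] at h5
      rw [← h5]
      congr 1
      linarith
    obtain ⟨s, hs⟩ := hwin y k hy.1 hk hr
    obtain ⟨s', hs'⟩ := hwin y' k' hy'.1 hk' hr'
    have hqz : (0:ℤ) < Q n := by exact_mod_cast hQ0 n
    have hal := hN (T n + (e n + s * ℓ n + k) * Q n) (T n + (e n + s' * ℓ n + k') * Q n) (by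
      intro i h1 h2
      have hm := Int.emod_nonneg i hqz.ne'
      have hm2 := Int.emod_lt_of_pos i hqz
      have hdm := Int.mul_ediv_add_emod i (Q n)
      set d := i / (Q n : ℤ) with hd
      set r := i % (Q n : ℤ) with hr0
      have hd1 : -(N + 1 : ℤ) ≤ d := by
        by_contra hcon
        have : d ≤ -(N + 1 : ℤ) - 1 := by omega
        nlinarith
      have hd2 : d ≤ N + 1 := by
        by_contra hcon
        have : (N + 1 : ℤ) + 1 ≤ d := by omega
        nlinarith
      have h3 := (hs d hd1 hd2).symm.trans (hs' d hd1 hd2)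
      rw [lev_eq] at h3
      have h4 := h3 r.toNat (by omega)
      rw [show ((r.toNat : ℕ) : ℤ) = r by omega] at h4
      rw [← hdm]
      convert h4 using 2 <;> ring)
    have hkk : k = k' := by
      obtain ⟨c, hc⟩ := hal
      rw [hQ] at hc
      push_cast at hc
      have h1 : (Q n : ℤ) * ((k:ℤ) - k') = Q n * (ℓ n * (c - s + s')) := by linarith
      have h2 := mul_left_cancel₀ hqz.ne' h1
      have h3 : (ℓ n : ℤ) ∣ (k:ℤ) - k' := ⟨_, h2⟩
      have h4 := Int.eq_zero_of_abs_lt_dvd h3 (by rw [abs_lt]; omega)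
      omega
    refine ⟨?_, hkk⟩
    subst hkk
    funext j
    obtain ⟨a, ha⟩ := lev_surj (y j)
    obtain ⟨a', ha'⟩ := lev_surj (y' j)
    rw [← ha, ← ha', lev_succ hQ0 hQ hT, ← hsl, ← hsl, ha, ha']
    apply List.ext_getElem?
    intro m
    by_cases hm : m < ℓ n
    · rw [hr j m hm, hr' j m hm]
    · rw [List.getElem?_eq_none (by rw [hslen]; omega),
        List.getElem?_eq_none (by rw [hslen]; omega)]
  · -- rank
    intro N
    refine ⟨N + 1, by omega, ?_⟩
    obtain ⟨c, hc⟩ := htwo N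
    let F : Bool → Blk x Q T (N+1) := fun b =>
      if h : ∃ k, c k = b then lev x Q T (N+1) h.choose else lev x Q T (N+1) 0
    have hF : Function.Surjective F := by
      intro b
      obtain ⟨k, rfl⟩ := lev_surj b
      refine ⟨c k, ?_⟩
      have h : ∃ k', c k' = c k := ⟨k, rfl⟩
      simp only [F, dif_pos h]
      exact hc _ _ h.choose_spec
    letI := @Fintype.ofFinite _ (hfin (N+1))
    have := Fintype.card_le_of_surjective F hF
    simpa using this
  · -- conjugacy
    letI : TopologicalSpace (Blk x Q T 0) := ⊥
    haveI : DiscreteTopology (Blk x Q T 0) := ⟨rfl⟩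
    let r : Blk x Q T 0 → A := fun b => x (Quotient.out b)
    have hlev0 : ∀ k k', lev x Q T 0 k = lev x Q T 0 k' ↔ x k = x k' := by
      intro k k'
      rw [lev_eq, hQ00, hT00]
      constructor
      · intro h; simpa using h 0 one_pos
      · intro h i hi
        have : i = 0 := by omega
        subst this
        simpa using h
    have hr : ∀ k, r (lev x Q T 0 k) = x k := fun k =>
      (hlev0 _ _).mp (Quotient.out_eq (lev x Q T 0 k))
    let gg : A → Blk x Q T 0 := fun a =>
      if h : ∃ k, x k = a then lev x Q T 0 h.choose else lev x Q T 0 0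
    have hgg : ∀ k, gg (x k) = lev x Q T 0 k := by
      intro k
      have h : ∃ k', x k' = x k := ⟨k, rfl⟩
      simp only [gg, dif_pos h]
      exact (hlev0 _ _).mpr h.choose_spec
    have hval : ∀ y ∈ X, ∀ i, ∃ k, x k = y i := by
      intro y hy i
      obtain ⟨L, hL⟩ := unif_rec hX hx hy i 1
      obtain ⟨s, -, -, hs⟩ := hL 0
      exact ⟨s, by simpa using hs 0 one_pos⟩
    have hXcl : ∀ y, (∀ (i : ℤ) (n : ℕ), ∃ j : ℤ, ∀ m : ℕ, m < n → x (j + m) = y (i + m)) →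
        y ∈ X := by
      intro y hy
      obtain ⟨x0, hg⟩ := id hX
      have hx0 := hx
      rw [hg.2] at hx0 ⊢
      apply mem_closure_of_factor
      intro i n
      obtain ⟨j, hj⟩ := hy i n
      obtain ⟨j', hj'⟩ := factor_of_closure hx0 j n
      exact ⟨j', fun m hm => (hj' m hm).trans (hj m hm)⟩
    have hto : ∀ y ∈ X, (fun i => gg (y i)) ∈ XLevel σ 0 := by
      intro y hy i m
      obtain ⟨L, hL⟩ := unif_rec hX hx hy i m
      obtain ⟨E, Λ, h1, h2⟩ := sadic_lev (x := x) hQ0 hQ hT 0 (L + m + 1)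
      have h3 := pow_le_Q hQ0 hQ hl 0 (L + m + 1)
      rw [h1, hQ00, one_mul] at h3
      refine ⟨L + m + 1, by omega, lev x Q T _ 0, ?_⟩
      rw [hσ, h2]
      obtain ⟨s, hs1, hs2, hs3⟩ := hL (E + 0 * Λ)
      apply infix_of_get (s := (s - (E + 0 * Λ)).toNat)
      intro j hj
      rw [factorAt_get (by omega)]
      congr 1
      rw [← hs3 j hj, hgg]
      congr 1; push_cast; omega
    have hfrom : ∀ y ∈ XLevel σ 0, (fun i => r (y i)) ∈ X := by
      intro y hy
      apply hXcl
      intro i n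
      obtain ⟨s, hs⟩ := hlevfac 0 y hy i n
      exact ⟨s, fun m hm => by show _ = r (y (i + m)); rw [hs m hm, hr]⟩
    refine ⟨{ toFun := fun y => ⟨fun i => gg (y.1 i), hto y.1 y.2⟩
              invFun := fun y => ⟨fun i => r (y.1 i), hfrom y.1 y.2⟩
              left_inv := ?_
              right_inv := ?_
              continuous_toFun := ?_
              continuous_invFun := ?_ }, ?_⟩
    · intro y
      apply Subtype.ext
      funext i
      obtain ⟨k, hk⟩ := hval y.1 y.2 i
      simp only
      rw [← hk, hgg, hr]
    · intro y
      apply Subtype.ext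
      funext i
      obtain ⟨k, hk⟩ := lev_surj (y.1 i)
      simp only
      rw [← hk, hr, hgg]
    · apply Continuous.subtype_mk
      apply continuous_pi
      intro i
      exact (continuous_of_discreteTopology (f := gg)).comp
        ((continuous_apply i).comp continuous_subtype_val)
    · apply Continuous.subtype_mk
      apply continuous_pi
      intro i
      exact (continuous_of_discreteTopology (f := r)).comp
        ((continuous_apply i).comp continuous_subtype_val)
    · intro y hy hy'
      rfl

/-! ### From S-adic representations to cuts -/

/-- `y` is, up to a shift by `k`, the concatenation of the words `f (z j)` of length `l`. -/
def RepW (f : B → List C) (l : ℕ) (z : ℤ → B) (k : ℤ) (y : ℤ → C) : Prop :=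
  ∀ (j : ℤ) (m : ℕ), m < l → (f (z j))[m]? = some (y (j * l + m - k))

theorem RepW.comp {D : Type*} {f : B → List C} {g : D → List B} {l L : ℕ}
    {y : ℤ → C} {z : ℤ → B} {z' : ℤ → D} {k k' : ℤ} (hf : ∀ b, (f b).length = l)
    (h : RepW f l z k y) (h' : RepW g L z' k' z) :
    RepW (fun d => (g d).flatMap f) (L * l) z' (k' * l + k) y := by
  intro j m hm
  have hl : 0 < l := by
    rcases Nat.eq_zero_or_pos l with h0 | h0
    · subst h0; simp at hm
    · exact h0
  have hq : m / l < L := by rw [Nat.div_lt_iff_lt_mul hl]; exact hm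
  have hr : m % l < l := Nat.mod_lt _ hl
  have e := Nat.div_add_mod m l
  have h1 := h' j (m / l) hq
  have h2 := flatMap_get hf (g (z' j)) h1 hr
  have h3 := (h (j * L + (m / l : ℕ) - k') _ hr).symm
  have e' : m / l * l + m % l = m := by rw [mul_comm]; exact e
  rw [e'] at h2
  show ((g (z' j)).flatMap f)[m]? = _
  rw [h2, ← h3]
  congr 2
  have ez : (m:ℤ) = (m / l : ℕ) * l + (m % l : ℕ) := by exact_mod_cast e'.symm
  rw [ez]; push_cast; ring

theorem RepW.decomp {D : Type*} {f : B → List C} {g : D → List B} {l L : ℕ}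
    {y : ℤ → C} {z' : ℤ → D} {k k' : ℤ} (hf : ∀ b, (f b).length = l)
    (hL : 0 < L) (hg : ∀ d, (g d).length = L)
    (h : RepW (fun d => (g d).flatMap f) (L * l) z' (k' * l + k) y) :
    ∃ z, RepW f l z k y ∧ RepW g L z' k' z := by
  have hLz : (0:ℤ) < L := by exact_mod_cast hL
  have hex : ∀ i : ℤ, ∃ b, (g (z' ((i + k') / L)))[((i + k') % L).toNat]? = some b := by
    intro i
    have h1 := Int.emod_nonneg (i + k') hLz.ne'
    have h2 := Int.emod_lt_of_pos (i + k') hLz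
    have : ((i + k') % L).toNat < (g (z' ((i + k') / L))).length := by rw [hg]; omega
    exact ⟨_, List.getElem?_eq_getElem this⟩
  choose z hz using hex
  have hrep : RepW g L z' k' z := by
    intro j m hm
    have := hz (j * L + m - k')
    have e1 : (j * L + m - k' + k') / L = j := by
      rw [sub_add_cancel, add_comm, Int.add_mul_ediv_right _ _ hLz.ne',
        Int.ediv_eq_zero_of_lt (by omega) (by omega), zero_add]
    have e2 : (j * L + m - k' + k') % L = m := by
      rw [sub_add_cancel, add_comm, Int.add_mul_emod_self_right]
      exact Int.emod_eq_of_lt (by omega) (by omega)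
    rw [e1, e2] at this
    simpa using this
  refine ⟨z, ?_, hrep⟩
  intro i m hm
  have h1 := Int.emod_nonneg (i + k') hLz.ne'
  have h2 := Int.emod_lt_of_pos (i + k') hLz
  have h3 := Int.emod_add_mul_ediv (i + k') L
  have hgl : ((i + k') % L).toNat < L := by omega
  have h5 := flatMap_get hf _ (hz i) hm
  have hlt : ((i + k') % L).toNat * l + m < L * l := by
    calc _ < ((i + k') % L).toNat * l + l := by omega
      _ = (((i + k') % L).toNat + 1) * l := by ring
      _ ≤ L * l := Nat.mul_le_mul_right _ hgl
  have h6 := h ((i + k') / L) _ hlt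
  rw [← h5]
  refine h6.trans ?_
  congr 2
  push_cast
  rw [Int.toNat_of_nonneg h1]
  linear_combination (l:ℤ) * h3

/-- Compactness in elementary form. -/
theorem compact_seq {D : Type*} [Finite D] (P : ℕ → (ℤ → D) → Prop)
    (hloc : ∀ n, ∃ N : ℕ, ∀ z z' : ℤ → D, (∀ i : ℤ, -N ≤ i → i ≤ N → z i = z' i) →
      P n z → P n z')
    (hanti : ∀ n z, P (n+1) z → P n z) (hne : ∀ n, ∃ z, P n z) : ∃ z, ∀ n, P n z := by
  letI : TopologicalSpace D := ⊥
  haveI : DiscreteTopology D := ⟨rfl⟩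
  have hcl : ∀ n, IsClosed {z | P n z} := by
    intro n
    obtain ⟨N, hN⟩ := hloc n
    rw [← isOpen_compl_iff, isOpen_iff_mem_nhds]
    intro z hz
    have : (Set.Icc (-(N:ℤ)) N).pi (fun i => {z i}) ∈ nhds z := by
      apply set_pi_mem_nhds (Set.finite_Icc _ _)
      intro i _
      simp
    filter_upwards [this] with z' hz' hP
    apply hz
    apply hN z' z _ hP
    intro i h1 h2
    exact hz' i ⟨h1, h2⟩
  have := IsCompact.nonempty_iInter_of_sequence_nonempty_isCompact_isClosed
    (fun n => {z | P n z}) (fun n z hz => hanti n z hz) hne (hcl 0).isCompact hcl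
  obtain ⟨z, hz⟩ := this
  exact ⟨z, fun n => Set.mem_iInter.1 hz n⟩

theorem window_lemma {D : Type*} [Finite A] [TopologicalSpace A] [DiscreteTopology A]
    {X : Set (ℤ → A)} (hX : IsClosed X) [TopologicalSpace D] [DiscreteTopology D] (f : X → D)
    (hf : Continuous f) :
    ∃ N : ℕ, ∀ u v : X, (∀ i : ℤ, -N ≤ i → i ≤ N → u.1 i = v.1 i) → f u = f v := by
  by_contra hcon
  push Not at hcon
  haveI : CompactSpace X := isCompact_iff_compactSpace.1 hX.isCompact
  have hcl : ∀ N : ℕ, IsClosed {w : X × X | (∀ i : ℤ, -N ≤ i → i ≤ N → w.1.1 i = w.2.1 i) ∧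
      f w.1 ≠ f w.2} := by
    intro N
    apply IsClosed.inter
    · have e : {w : X × X | ∀ i : ℤ, -N ≤ i → i ≤ N → w.1.1 i = w.2.1 i} =
          ⋂ (i : ℤ) (_ : -(N:ℤ) ≤ i) (_ : i ≤ N), {w : X × X | w.1.1 i = w.2.1 i} := by
        ext w; simp
      change IsClosed {w : X × X | ∀ i : ℤ, -N ≤ i → i ≤ N → w.1.1 i = w.2.1 i}
      rw [e]
      refine isClosed_iInter fun i => isClosed_iInter fun _ => isClosed_iInter fun _ => ?_
      exact isClosed_eq ((continuous_apply i).comp (continuous_subtype_val.comp continuous_fst))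
        ((continuous_apply i).comp (continuous_subtype_val.comp continuous_snd))
    · have : Continuous fun w : X × X => (f w.1, f w.2) := by fun_prop
      exact (isClosed_discrete {p : D × D | p.1 ≠ p.2}).preimage this
  have := IsCompact.nonempty_iInter_of_sequence_nonempty_isCompact_isClosed
    (fun N : ℕ => {w : X × X | (∀ i : ℤ, -N ≤ i → i ≤ N → w.1.1 i = w.2.1 i) ∧
      f w.1 ≠ f w.2})
    (fun n w hw => ⟨fun i h1 h2 => hw.1 i (by push_cast; omega) (by push_cast; omega), hw.2⟩)
    (fun N => by
      obtain ⟨u, v, h1, h2⟩ := hcon N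
      exact ⟨(u, v), h1, h2⟩) (hcl 0).isCompact hcl
  obtain ⟨w, hw⟩ := this
  rw [Set.mem_iInter] at hw
  apply (hw 0).2
  congr 1
  apply Subtype.ext
  funext i
  exact (hw i.natAbs).1 i (by omega) (by omega)

/-! #### Levels -/

theorem flatMap_heq {D : ℕ → Type*} (σ : ∀ n, D (n+1) → List (D n)) {M N : ℕ} (e : M = N)
    (a : D (M+1)) (a' : D (N+1)) (ha : HEq a a') (f : D M → List C) (f' : D N → List C)
    (hf : ∀ b b', HEq b b' → f b = f' b') : (σ M a).flatMap f = (σ N a').flatMap f' := by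
  subst e
  obtain rfl := eq_of_heq ha
  have : f = f' := funext fun b => hf b b HEq.rfl
  rw [this]

theorem sadic_shift {D : ℕ → Type*} (σ : ∀ n, D (n+1) → List (D n)) (n k : ℕ) :
    ∀ (a : D (n + (k+1))) (a' : D (n + 1 + k)), HEq a a' →
      sadicWordAux σ n (k+1) a = (sadicWordAux σ (n+1) k a').flatMap (σ n) := by
  induction k with
  | zero =>
    intro a a' h
    obtain rfl := eq_of_heq h
    simp [sadicWordAux]
  | succ k ih =>
    intro a a' h
    rw [sadicWordAux, sadicWordAux, List.flatMap_assoc]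
    exact flatMap_heq σ (show n + (k+1) = n + 1 + k by omega) a a' h _ _ (fun b b' hb => ih b b' hb)

theorem sadic_shift_left {D : ℕ → Type*} (σ : ∀ n, D (n+1) → List (D n)) (n k : ℕ)
    (a : D (n + (k+1))) : ∃ a' : D (n + 1 + k),
      sadicWordAux σ n (k+1) a = (sadicWordAux σ (n+1) k a').flatMap (σ n) :=
  have e : n + (k+1) = n + 1 + k := by omega
  ⟨e ▸ a, sadic_shift σ n k a _ (by simp)⟩

theorem sadic_shift_right {D : ℕ → Type*} (σ : ∀ n, D (n+1) → List (D n)) (n k : ℕ)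
    (a' : D (n + 1 + k)) : ∃ a : D (n + (k+1)),
      sadicWordAux σ n (k+1) a = (sadicWordAux σ (n+1) k a').flatMap (σ n) :=
  have e : n + 1 + k = n + (k+1) := by omega
  ⟨e ▸ a', sadic_shift σ n k _ a' (by simp)⟩

/-- The central window of radius `M` is legal at level `n`. -/
def Legal {D : ℕ → Type*} (σ : ∀ n, D (n+1) → List (D n)) (n M : ℕ) (z : ℤ → D n) : Prop :=
  ∃ k : ℕ, 0 < k ∧ ∃ a : D (n+k), (factorAt z (-M) (2*M+1)).IsInfix (sadicWordAux σ n k a)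

theorem infix_sub {y : ℤ → A} {i i' : ℤ} {m m' : ℕ} (h1 : i' ≤ i) (h2 : i + m ≤ i' + m') :
    factorAt y i m <:+: factorAt y i' m' := by
  apply infix_of_get (s := (i - i').toNat)
  intro j hj
  rw [factorAt_get (by omega)]
  congr 2; push_cast; omega

theorem mem_XLevel_iff {D : ℕ → Type*} (σ : ∀ n, D (n+1) → List (D n)) (n : ℕ) (z : ℤ → D n) :
    z ∈ XLevel σ n ↔ ∀ M, Legal σ n M z := by
  constructor
  · intro h M
    exact h _ _
  · intro h i m
    obtain ⟨k, hk, a, ha⟩ := h (i.natAbs + m)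
    exact ⟨k, hk, a, (infix_sub (by omega) (by omega)).trans ha⟩

theorem Legal.mono {D : ℕ → Type*} {σ : ∀ n, D (n+1) → List (D n)} {n M M' : ℕ} {z : ℤ → D n}
    (h : Legal σ n M z) (hM : M' ≤ M) : Legal σ n M' z := by
  obtain ⟨k, hk, a, ha⟩ := h
  exact ⟨k, hk, a, (infix_sub (by push_cast; omega) (by push_cast; omega)).trans ha⟩

theorem Legal.congr {D : ℕ → Type*} {σ : ∀ n, D (n+1) → List (D n)} {n M : ℕ} {z z' : ℤ → D n}
    (h : Legal σ n M z) (hz : ∀ i : ℤ, -M ≤ i → i ≤ M → z i = z' i) : Legal σ n M z' := by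
  obtain ⟨k, hk, a, ha⟩ := h
  refine ⟨k, hk, a, ?_⟩
  rwa [← factorAt_congr.2 fun m hm => hz (-M + m) (by omega) (by omega)]

/-- Desubstitution. -/
theorem one_step {D : ℕ → Type*} [∀ n, Finite (D n)] {σ : ∀ n, D (n+1) → List (D n)} {n l : ℕ}
    (hl : 0 < l) (hlen : ∀ a, (σ n a).length = l) {z : ℤ → D n} (hz : z ∈ XLevel σ n) :
    ∃ z' ∈ XLevel σ (n+1), ∃ k : ℕ, k < l ∧ RepW (σ n) l z' k z := by
  let P : ℕ → ℕ → (ℤ → D (n+1)) → Prop := fun k M z' => Legal σ (n+1) M z' ∧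
    ∀ j : ℤ, -M ≤ j → j ≤ M → ∀ m : ℕ, m < l → (σ n (z' j))[m]? = some (z (j * l + m - k))
  have hne : ∀ M, ∃ k, k < l ∧ ∃ z', P k M z' := by
    intro M
    obtain ⟨K, hK, a, ha⟩ := hz (-((M+2) * l : ℕ)) ((2*M+5) * l)
    obtain ⟨s, hs1, hs2⟩ := infix_get ha
    obtain ⟨K, rfl⟩ : ∃ K', K = K' + 1 := ⟨K - 1, by omega⟩
    obtain ⟨a', ha'⟩ := sadic_shift_left σ n K a
    rw [ha'] at hs1 hs2
    rw [flatMap_length hlen] at hs1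
    set W := sadicWordAux σ (n+1) K a' with hW
    have hK0 : 0 < K := by
      rcases Nat.eq_zero_or_pos K with h0 | h0
      · exfalso
        subst h0
        have : W.length = 1 := by rw [hW]; simp [sadicWordAux]
        rw [this] at hs1
        have : 5 * l ≤ (2 * M + 5) * l := Nat.mul_le_mul_right _ (by omega)
        omega
      · exact h0
    set o := s + (M+2) * l with ho
    set g0 := o / l with hg0
    have hdm : g0 * l + o % l = o := by rw [mul_comm]; exact Nat.div_add_mod o l
    have hk : o % l < l := Nat.mod_lt _ hl
    have hg1 : M + 2 ≤ g0 := by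
      rw [hg0, Nat.le_div_iff_mul_le hl]; omega
    have hg2 : g0 + M + 1 < W.length := by
      by_contra hcon
      have h1 : W.length * l ≤ (g0 + M + 1) * l := Nat.mul_le_mul_right _ (by omega)
      have e1 : (g0 + M + 1) * l = g0 * l + M * l + l := by ring
      have e2 : (2*M+5) * l = 2 * (M * l) + 5 * l := by ring
      have e3 : (M+2) * l = M * l + 2 * l := by ring
      omega
    have hWpos : 0 < W.length := by omega
    let z' : ℤ → D (n+1) := fun j => (W[(g0 + j).toNat]?).getD (W[0])
    have hz' : ∀ j : ℤ, -M ≤ j → j ≤ M → W[(g0 + j).toNat]? = some (z' j) := by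
      intro j h1 h2
      have : (g0 + j).toNat < W.length := by omega
      simp [z', List.getElem?_eq_getElem this]
    refine ⟨o % l, hk, z', ⟨K, hK0, a', ?_⟩, ?_⟩
    · apply infix_of_get (s := g0 - M)
      intro j hj
      rw [← hz' (-M + j) (by omega) (by omega)]
      congr 1; omega
    · intro j h1 h2 m hm
      have e := flatMap_get hlen W (hz' j h1 h2) hm
      rw [← e]
      have hb1 : ((o % l : ℕ) : ℤ) < l := by exact_mod_cast hk
      have hlz : (0:ℤ) < l := by exact_mod_cast hl
      have hjl : -(M * l : ℤ) ≤ j * l := by nlinarith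
      have hjl' : j * (l:ℤ) ≤ M * l := by nlinarith
      have hr0 : (0:ℤ) ≤ (o % l : ℕ) := by omega
      have hml : (m:ℤ) < l := by exact_mod_cast hm
      have hMl : (0:ℤ) ≤ M * l := by positivity
      have hnn : 0 ≤ ((M + 2 : ℕ) : ℤ) * l + j * l + m - (o % l : ℕ) := by
        rw [Nat.cast_add, add_mul, Nat.cast_ofNat]; linarith
      obtain ⟨d, hd⟩ := Int.eq_ofNat_of_zero_le hnn
      have hlt : d < (2*M+5) * l := by
        have : (d:ℤ) < ((2*M+5 : ℕ) : ℤ) * l := by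
          rw [← hd, Nat.cast_add, Nat.cast_add, Nat.cast_mul, add_mul, add_mul, Nat.cast_ofNat,
            Nat.cast_ofNat]
          linarith
        exact_mod_cast this
      have hh := hs2 d hlt
      have e1 : s + d = (g0 + j).toNat * l + m := by
        have hdz : (g0 : ℤ) * l + (o % l : ℕ) = s + ((M + 2 : ℕ) : ℤ) * l := by
          exact_mod_cast hdm
        have : ((s + d : ℕ) : ℤ) = (((g0 + j).toNat * l + m : ℕ) : ℤ) := by
          rw [Nat.cast_add, Nat.cast_add, Nat.cast_mul, Int.toNat_of_nonneg (by omega), ← hd]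
          linear_combination -hdz
        exact_mod_cast this
      rw [e1] at hh
      rw [hh]
      congr 2
      rw [← hd, Nat.cast_mul]; ring
  have hmono : ∀ k M M' z', M' ≤ M → P k M z' → P k M' z' := by
    intro k M M' z' h hp
    exact ⟨hp.1.mono h, fun j h1 h2 => hp.2 j (by omega) (by omega)⟩
  have hk : ∃ k, k < l ∧ ∀ M, ∃ z', P k M z' := by
    by_contra hcon
    push Not at hcon
    have hc : ∀ k, ∃ M, k < l → ∀ z', ¬ P k M z' := by
      intro k
      by_cases h : k < l
      · obtain ⟨M, hM⟩ := hcon k h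
        exact ⟨M, fun _ => hM⟩
      · exact ⟨0, fun h' => absurd h' h⟩
    choose F hF using hc
    obtain ⟨k, hk, z', hz'⟩ := hne ((Finset.range l).sup F)
    exact hF k hk z' (hmono _ _ _ _ (Finset.le_sup (Finset.mem_range.2 hk)) hz')
  obtain ⟨k, hk, hP⟩ := hk
  obtain ⟨z', hz'⟩ := compact_seq (P k)
    (fun M => ⟨M, fun u v huv hp => ⟨hp.1.congr huv, fun j h1 h2 m hm => by
      rw [← huv j h1 h2]; exact hp.2 j h1 h2 m hm⟩⟩)
    (fun M z' h => hmono k _ _ z' (Nat.le_succ M) h) hP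
  refine ⟨z', (mem_XLevel_iff σ (n+1) z').2 fun M => (hz' M).1, k, hk, ?_⟩
  intro j m hm
  exact (hz' j.natAbs).2 j (by omega) (by omega) m hm

theorem subst_mem {D : ℕ → Type*} {σ : ∀ n, D (n+1) → List (D n)} {n l : ℕ}
    (hl : 0 < l) (hlen : ∀ a, (σ n a).length = l) {z : ℤ → D (n+1)} (hz : z ∈ XLevel σ (n+1))
    {k : ℤ} {y : ℤ → D n} (h : RepW (σ n) l z k y) : y ∈ XLevel σ n := by
  intro i m
  have hlz : (0:ℤ) < l := by exact_mod_cast hl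
  obtain ⟨K, hK, a', ha⟩ := hz ((i + k) / l) (m + 1)
  obtain ⟨s, hs1, hs2⟩ := infix_get ha
  obtain ⟨a, ha'⟩ := sadic_shift_right σ n K a'
  refine ⟨K+1, by omega, a, ?_⟩
  rw [ha']
  have h1 := Int.emod_nonneg (i + k) hlz.ne'
  have h2 := Int.emod_lt_of_pos (i + k) hlz
  have h3 := Int.emod_add_mul_ediv (i + k) l
  obtain ⟨r, hr⟩ := Int.eq_ofNat_of_zero_le h1
  apply infix_of_get (s := s * l + r)
  intro t ht
  have hq : (r + t) / l < m + 1 := by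
    rw [Nat.div_lt_iff_lt_mul hl]; nlinarith [show r < l by omega]
  have hrt : (r + t) % l < l := Nat.mod_lt _ hl
  have hdm : (r + t) / l * l + (r + t) % l = r + t := by rw [mul_comm]; exact Nat.div_add_mod _ _
  have e := flatMap_get hlen _ (hs2 _ hq) hrt
  have e2 := h ((i + k) / l + ((r + t) / l : ℕ)) _ hrt
  have e3 : s * l + r + t = (s + (r + t) / l) * l + (r + t) % l := by
    rw [add_mul, add_assoc, add_assoc, hdm]
  rw [e3, e, e2]
  congr 2
  have hdz : (((r + t) / l : ℕ) : ℤ) * l + ((r + t) % l : ℕ) = r + t := by exact_mod_cast hdm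
  rw [hr] at h3
  linear_combination h3 + hdz

/-- Lengths of the words `word0 σ n a`. -/
def hh (ℓ : ℕ → ℕ) : ℕ → ℕ
  | 0 => 1
  | (n+1) => ℓ n * hh ℓ n

theorem word0_length {D : ℕ → Type*} {σ : ∀ n, D (n+1) → List (D n)} {ℓ : ℕ → ℕ}
    (hlen : ∀ n a, (σ n a).length = ℓ n) (n : ℕ) : ∀ a, (word0 σ n a).length = hh ℓ n := by
  induction n with
  | zero => intro a; rfl
  | succ n ih =>
    intro a
    rw [word0, flatMap_length ih, hlen]; rfl

theorem exists_rep {D : ℕ → Type*} [∀ n, Finite (D n)] {σ : ∀ n, D (n+1) → List (D n)}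
    {ℓ : ℕ → ℕ} (hl : ∀ n, 0 < ℓ n)
    (hlen : ∀ n a, (σ n a).length = ℓ n) {y : ℤ → D 0} (hy : y ∈ XLevel σ 0) (n : ℕ) :
    ∃ z ∈ XLevel σ n, ∃ k : ℕ, k < hh ℓ n ∧ RepW (word0 σ n) (hh ℓ n) z k y := by
  induction n with
  | zero =>
    refine ⟨y, hy, 0, by simp [hh], ?_⟩
    intro j m hm
    have : m = 0 := by simpa [hh] using hm
    subst this
    simp [hh, word0]
  | succ n ih =>
    obtain ⟨z, hz, k, hk, hr⟩ := ih
    obtain ⟨z', hz', k', hk', hr'⟩ := one_step (hl n) (hlen n) hz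
    refine ⟨z', hz', k' * hh ℓ n + k, ?_, ?_⟩
    · show _ < ℓ n * hh ℓ n
      nlinarith
    · have := hr.comp (word0_length hlen n) hr'
      push_cast
      exact this

theorem uniq_rep {D : ℕ → Type*} {σ : ∀ n, D (n+1) → List (D n)}
    {ℓ : ℕ → ℕ} (hl : ∀ n, 0 < ℓ n)
    (hlen : ∀ n a, (σ n a).length = ℓ n) (hrec : RecognizableSeq σ) (n : ℕ) :
    ∀ (y : ℤ → D 0) (z z' : ℤ → D n) (k k' : ℕ), z ∈ XLevel σ n → z' ∈ XLevel σ n →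
      k < hh ℓ n → k' < hh ℓ n →
      RepW (word0 σ n) (hh ℓ n) z k y → RepW (word0 σ n) (hh ℓ n) z' k' y → z = z' ∧ k = k' := by
  induction n with
  | zero =>
    intro y z z' k k' _ _ hk hk' h h'
    simp only [hh, Nat.lt_one_iff] at hk hk'
    subst hk hk'
    refine ⟨?_, rfl⟩
    funext j
    have h1 := h j 0 (by simp [hh])
    have h2 := h' j 0 (by simp [hh])
    rw [← h2] at h1
    simpa [word0] using h1
  | succ n ih =>
    intro y z z' k k' hz hz' hk hk' h h'
    have hpos : 0 < hh ℓ n := by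
      rcases Nat.eq_zero_or_pos (hh ℓ n) with h0 | h0
      · simp [hh, h0] at hk
      · exact h0
    have key : ∀ (z : ℤ → D (n+1)) (k : ℕ), z ∈ XLevel σ (n+1) → k < hh ℓ (n+1) →
        RepW (word0 σ (n+1)) (hh ℓ (n+1)) z k y → ∃ w ∈ XLevel σ n,
          RepW (word0 σ n) (hh ℓ n) w (k % hh ℓ n : ℕ) y ∧
          IsCenteredRep (σ n) (XLevel σ (n+1)) w z (k / hh ℓ n) := by
      intro z k hz hk h
      have hdm : k / hh ℓ n * hh ℓ n + k % hh ℓ n = k := by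
        rw [mul_comm]; exact Nat.div_add_mod _ _
      have h1 : RepW (fun d => (σ n d).flatMap (word0 σ n)) (ℓ n * hh ℓ n) z
          (((k / hh ℓ n : ℕ) : ℤ) * hh ℓ n + (k % hh ℓ n : ℕ)) y := by
        have e : ((k / hh ℓ n : ℕ) : ℤ) * hh ℓ n + (k % hh ℓ n : ℕ) = k := by exact_mod_cast hdm
        rw [e]; exact h
      obtain ⟨w, hw1, hw2⟩ := h1.decomp (word0_length hlen n) (hl n) (hlen n)
      refine ⟨w, subst_mem (hl n) (hlen n) hz hw2, hw1, hz, ?_, fun j => j * ℓ n, by simp, ?_, ?_⟩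
      · rw [hlen, Nat.div_lt_iff_lt_mul hpos]; exact hk
      · intro j; rw [hlen]; ring
      · intro j m
        have hm : (m : ℕ) < ℓ n := hlen n (z j) ▸ m.2
        have := hw2 j m hm
        rw [List.getElem?_eq_getElem m.2] at this
        exact (Option.some.inj this).symm
    obtain ⟨w, hw, hw1, hw2⟩ := key z k hz hk h
    obtain ⟨w', hw', hw1', hw2'⟩ := key z' k' hz' hk' h'
    obtain ⟨e1, e2⟩ := ih y w w' _ _ hw hw' (Nat.mod_lt _ hpos) (Nat.mod_lt _ hpos) hw1 hw1'
    subst e1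
    obtain ⟨e3, e4⟩ := hrec n _ _ _ _ _ hw2 hw2'
    refine ⟨e3, ?_⟩
    rw [← Nat.div_add_mod k (hh ℓ n), ← Nat.div_add_mod k' (hh ℓ n), e2, e4]

/-- A representation valid on a finite window. -/
def PR {D : ℕ → Type*} (σ : ∀ n, D (n+1) → List (D n)) (n h N : ℕ) (z : ℤ → D n) (k : ℕ)
    (y : ℤ → D 0) : Prop :=
  Legal σ n N z ∧ ∀ j : ℤ, -N ≤ j → j ≤ N → ∀ m : ℕ, m < h →
    (word0 σ n (z j))[m]? = some (y (j * h + m - k))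

theorem shiftBy_mem_XLevel {D : ℕ → Type*} {σ : ∀ n, D (n+1) → List (D n)} {n : ℕ} {z : ℤ → D n}
    (hz : z ∈ XLevel σ n) (a : ℤ) : shiftBy a z ∈ XLevel σ n := by
  intro i m
  obtain ⟨k, hk, b, hb⟩ := hz (i + a) m
  refine ⟨k, hk, b, ?_⟩
  have : factorAt (shiftBy a z) i m = factorAt z (i + a) m := by
    rw [factorAt_congr]
    intro j _
    show z _ = z _
    congr 1; ring
  rwa [this]

theorem al_level {D : ℕ → Type*} [∀ n, Finite (D n)] {σ : ∀ n, D (n+1) → List (D n)}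
    {ℓ : ℕ → ℕ} (hl : ∀ n, 0 < ℓ n)
    (hlen : ∀ n a, (σ n a).length = ℓ n) (hrec : RecognizableSeq σ)
    {y : ℤ → D 0} (hy : y ∈ XLevel σ 0) (n : ℕ) : ∃ N, Al y (hh ℓ n) N := by
  obtain ⟨z, hz, k, hk, hr⟩ := exists_rep hl hlen hy n
  set h := hh ℓ n with hh_def
  have hpos : 0 < h := by omega
  have hposz : (0:ℤ) < h := by exact_mod_cast hpos
  by_contra hcon
  push Not at hcon
  -- shifted representations
  have hsh : ∀ a : ℤ, ∃ κ : Fin h, ((κ : ℕ) : ℤ) = (k + a) % h ∧ ∃ w ∈ XLevel σ n,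
      RepW (word0 σ n) h w ((κ : ℕ) : ℤ) (shiftBy a y) := by
    intro a
    have h1 := Int.emod_nonneg (k + a) hposz.ne'
    have h2 := Int.emod_lt_of_pos (k + a) hposz
    have h3 := Int.emod_add_mul_ediv (k + a) h
    obtain ⟨κ, hκ⟩ := Int.eq_ofNat_of_zero_le h1
    refine ⟨⟨κ, by omega⟩, hκ.symm, shiftBy ((k + a) / h) z, shiftBy_mem_XLevel hz _, ?_⟩
    intro j m hm
    have := hr (j + (k + a) / h) m hm
    refine this.trans ?_
    show _ = some (y _)
    congr 2
    show _ = j * (h:ℤ) + m - κ + a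
    rw [← hκ]
    linear_combination h3
  let E := D 0 × D 0 × D n × D n × Fin h × Fin h
  let P : ℕ → (ℤ → E) → Prop := fun N w =>
    (w 0).2.2.2.2.1 ≠ (w 0).2.2.2.2.2 ∧
    (∀ i : ℤ, -N ≤ i → i ≤ N → (w i).1 = (w i).2.1) ∧
    PR σ n h N (fun i => (w i).2.2.1) (w 0).2.2.2.2.1 (fun i => (w i).1) ∧
    PR σ n h N (fun i => (w i).2.2.2.1) (w 0).2.2.2.2.2 (fun i => (w i).2.1)
  have hprcongr : ∀ N (z z' : ℤ → D n) (κ : Fin h) (y y' : ℤ → D 0),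
      (∀ i : ℤ, -((N + 1) * h + N : ℕ) ≤ i → i ≤ ((N + 1) * h + N : ℕ) → z i = z' i) →
      (∀ i : ℤ, -((N + 1) * h + N : ℕ) ≤ i → i ≤ ((N + 1) * h + N : ℕ) → y i = y' i) →
      PR σ n h N z κ y → PR σ n h N z' κ y' := by
    intro N z z' κ y y' h1 h2 hP
    have hb : (0:ℤ) ≤ ((N + 1) * h : ℕ) := by omega
    have hb' : (((N + 1) * h : ℕ) : ℤ) = N * h + h := by push_cast; ring
    refine ⟨hP.1.congr fun i hi hi' => h1 i (by omega) (by omega), fun j hj hj' m hm => ?_⟩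
    have hκ := κ.2
    have : -(N * h : ℤ) ≤ j * h := by nlinarith
    have : j * (h:ℤ) ≤ N * h := by nlinarith
    rw [← h1 j (by omega) (by omega), ← h2 (j * h + m - (κ : ℕ)) (by rw [Nat.cast_add, hb']; omega) (by rw [Nat.cast_add, hb']; omega)]
    exact hP.2 j hj hj' m hm
  obtain ⟨w, hw⟩ := compact_seq P (by
    intro N
    refine ⟨(N + 1) * h + N, fun u v huv hP => ?_⟩
    have h0 := huv 0 (by omega) (by omega)
    refine ⟨h0 ▸ hP.1, fun i hi hi' => ?_, ?_, ?_⟩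
    · rw [← huv i (by push_cast; nlinarith) (by push_cast; nlinarith)]
      exact hP.2.1 i hi hi'
    · rw [← h0]
      exact hprcongr N _ _ _ _ _ (fun i a b => by rw [huv i a b]) (fun i a b => by rw [huv i a b])
        hP.2.2.1
    · rw [← h0]
      exact hprcongr N _ _ _ _ _ (fun i a b => by rw [huv i a b]) (fun i a b => by rw [huv i a b])
        hP.2.2.2) (by
    intro N w hP
    exact ⟨hP.1, fun i a b => hP.2.1 i (by omega) (by omega),
      ⟨hP.2.2.1.1.mono (by omega), fun j a b => hP.2.2.1.2 j (by omega) (by omega)⟩,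
      ⟨hP.2.2.2.1.mono (by omega), fun j a b => hP.2.2.2.2 j (by omega) (by omega)⟩⟩) (by
    intro N
    have hN := hcon N
    unfold Al at hN
    push Not at hN
    obtain ⟨a, b, hab, hnd⟩ := hN
    obtain ⟨κ, hκ, u, hu, hru⟩ := hsh a
    obtain ⟨κ', hκ', v, hv, hrv⟩ := hsh b
    refine ⟨fun i => (shiftBy a y i, shiftBy b y i, u i, v i, κ, κ'), ?_, ?_, ?_, ?_⟩
    · intro he
      have he : κ = κ' := he
      apply hnd
      have : (k + b) % h = (k + a) % h := by rw [← hκ, ← hκ', he]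
      have h5 : (h:ℤ) ∣ (k + a) - (k + b) := Int.ModEq.dvd this
      simpa using h5
    · intro i h1 h2
      show y _ = y _
      rw [add_comm i a, add_comm i b]
      exact hab i h1 h2
    · exact ⟨(mem_XLevel_iff σ n u).1 hu N, fun j _ _ m hm => hru j m hm⟩
    · exact ⟨(mem_XLevel_iff σ n v).1 hv N, fun j _ _ m hm => hrv j m hm⟩)
  have hyy : (fun i => (w i).1) = fun i => (w i).2.1 := by
    funext i
    exact (hw i.natAbs).2.1 i (by omega) (by omega)
  have := uniq_rep hl hlen hrec n (fun i => (w i).1) (fun i => (w i).2.2.1)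
    (fun i => (w i).2.2.2.1) (w 0).2.2.2.2.1 (w 0).2.2.2.2.2
    ((mem_XLevel_iff σ n _).2 fun N => (hw N).2.2.1.1)
    ((mem_XLevel_iff σ n _).2 fun N => (hw N).2.2.2.1)
    (w 0).2.2.2.2.1.2 (w 0).2.2.2.2.2.2
    (fun j m hm => (hw j.natAbs).2.2.1.2 j (by omega) (by omega) m hm)
    (fun j m hm => by
      rw [hyy]; exact (hw j.natAbs).2.2.2.2 j (by omega) (by omega) m hm)
  exact (hw 0).1 (Fin.ext this.2)

/-! #### Codes -/

theorem shiftBy_mem_of_toeplitz [TopologicalSpace A] [DiscreteTopology A] {X : Set (ℤ → A)}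
    (hX : IsToeplitzSubshift X) {x : ℤ → A} (hx : x ∈ X) (a : ℤ) : shiftBy a x ∈ X := by
  obtain ⟨g, hg, rfl⟩ := hX
  apply mem_closure_of_factor
  intro i n
  obtain ⟨j, hj⟩ := factor_of_closure hx (i + a) n
  refine ⟨j, fun m hm => ?_⟩
  rw [hj m hm]
  show x _ = x _
  congr 1; ring

theorem equivariant_int {X : Set (ℤ → A)} {Y : Set (ℤ → B)} (f : X → Y)
    (hX : ∀ x ∈ X, ∀ a, shiftBy a x ∈ X)
    (hf : ∀ (x : ℤ → A) (hx : x ∈ X) (hx' : shift x ∈ X), (f ⟨shift x, hx'⟩).1 = shift (f ⟨x, hx⟩).1)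
    (x : ℤ → A) (hx : x ∈ X) (a : ℤ) :
    (f ⟨shiftBy a x, hX x hx a⟩).1 = shiftBy a (f ⟨x, hx⟩).1 := by
  have hstep : ∀ b : ℤ, (f ⟨shiftBy (b + 1) x, hX x hx _⟩).1 = shift (f ⟨shiftBy b x, hX x hx b⟩).1 := by
    intro b
    have e : shiftBy (b + 1) x = shift (shiftBy b x) := by
      funext i; show x _ = x _; congr 1; ring
    have := hf (shiftBy b x) (hX x hx b) (e ▸ hX x hx (b + 1))
    rw [← this]
    congr 2
    exact Subtype.ext e
  have h0 : (f ⟨shiftBy 0 x, hX x hx 0⟩).1 = shiftBy 0 (f ⟨x, hx⟩).1 := by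
    have e : (⟨shiftBy 0 x, hX x hx 0⟩ : X) = ⟨x, hx⟩ := Subtype.ext (by
      funext i; show x _ = x _; congr 1; ring)
    rw [e]
    funext i; show _ = (f ⟨x, hx⟩).1 _; congr 1; ring
  induction a using Int.induction_on with
  | zero => exact h0
  | succ b ih =>
    rw [hstep, ih]
    funext i
    show (f ⟨x, hx⟩).1 _ = (f ⟨x, hx⟩).1 _
    congr 1; ring
  | pred b ih =>
    have h1 := hstep (-b - 1)
    have e : (⟨shiftBy (-b - 1 + 1) x, hX x hx _⟩ : X) = ⟨shiftBy (-b) x, hX x hx _⟩ :=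
      Subtype.ext (by
        show shiftBy _ _ = shiftBy _ _
        congr 1; ring)
    rw [e, ih] at h1
    funext i
    have h2 := congrFun h1 (i - 1)
    have h3 : (f ⟨x, hx⟩).1 (i - 1 + -b) = (f ⟨shiftBy (-b - 1) x, hX x hx _⟩).1 (i - 1 + 1) := h2
    rw [sub_add_cancel] at h3
    rw [← h3]
    show _ = (f ⟨x, hx⟩).1 _
    congr 1; ring

theorem code_lemma [Finite A] [TopologicalSpace A] [DiscreteTopology A] [TopologicalSpace B]
    [DiscreteTopology B] {X : Set (ℤ → A)} {Y : Set (ℤ → B)} (hcl : IsClosed X) (f : X → Y)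
    (hc : Continuous f) (hX : ∀ x ∈ X, ∀ a, shiftBy a x ∈ X)
    (hf : ∀ (x : ℤ → A) (hx : x ∈ X) (hx' : shift x ∈ X), (f ⟨shift x, hx'⟩).1 = shift (f ⟨x, hx⟩).1)
    (x : ℤ → A) (hx : x ∈ X) : ∃ r : ℕ, ∀ a b : ℤ,
      (∀ i : ℤ, -r ≤ i → i ≤ r → x (a + i) = x (b + i)) → (f ⟨x, hx⟩).1 a = (f ⟨x, hx⟩).1 b := by
  obtain ⟨r, hr⟩ := window_lemma hcl (fun u : X => (f u).1 0)
    ((continuous_apply 0).comp (continuous_subtype_val.comp hc))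
  refine ⟨r, fun a b hab => ?_⟩
  have := hr ⟨shiftBy a x, hX x hx a⟩ ⟨shiftBy b x, hX x hx b⟩ (fun i h1 h2 => by
    show x (i + a) = x (i + b)
    rw [add_comm i a, add_comm i b]; exact hab i h1 h2)
  change (f _).1 0 = (f _).1 0 at this
  rw [equivariant_int f hX hf x hx a, equivariant_int f hX hf x hx b] at this
  simpa [shiftBy] using this

theorem conj_codes [Finite A] [TopologicalSpace A] [DiscreteTopology A] [Finite B]
    [TopologicalSpace B] [DiscreteTopology B] {X : Set (ℤ → A)} {Y : Set (ℤ → B)}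
    (hcl : IsClosed X) (hX : ∀ x ∈ X, ∀ a, shiftBy a x ∈ X) (hY : ∀ x ∈ Y, ∀ a, shiftBy a x ∈ Y)
    (h : Conjugate X Y) {x : ℤ → A} (hx : x ∈ X) : ∃ y ∈ Y,
      (∃ r : ℕ, ∀ a b : ℤ, (∀ i : ℤ, -r ≤ i → i ≤ r → y (a + i) = y (b + i)) → x a = x b) ∧
      (∃ r : ℕ, ∀ a b : ℤ, (∀ i : ℤ, -r ≤ i → i ≤ r → x (a + i) = x (b + i)) → y a = y b) := by
  obtain ⟨φ, hφ⟩ := h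
  haveI : CompactSpace X := isCompact_iff_compactSpace.1 hcl.isCompact
  haveI : CompactSpace Y := φ.compactSpace
  have hclY : IsClosed Y := (isCompact_iff_compactSpace.2 ‹_›).isClosed
  refine ⟨(φ ⟨x, hx⟩).1, (φ ⟨x, hx⟩).2, ?_, code_lemma hcl φ φ.continuous hX hφ x hx⟩
  have := code_lemma hclY φ.symm φ.symm.continuous hY (fun y hy hy' => by
    set u := φ.symm ⟨y, hy⟩ with hu
    have hu' : shift u.1 ∈ X := hX u.1 u.2 1
    have h1 := hφ u.1 u.2 hu'
    have h2 : φ ⟨shift u.1, hu'⟩ = ⟨shift y, hy'⟩ := by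
      apply Subtype.ext
      rw [h1]
      show shift (φ u).1 = _
      rw [hu, φ.apply_symm_apply]
    rw [← h2, φ.symm_apply_apply]) (φ ⟨x, hx⟩).1 (φ ⟨x, hx⟩).2
  simpa using this

theorem proper_rep {D : ℕ → Type*} {σ : ∀ n, D (n+1) → List (D n)}
    {ℓ : ℕ → ℕ} (hl : ∀ n, 0 < ℓ n) (hlen : ∀ n a, (σ n a).length = ℓ n) (hpr : ProperSeq σ)
    {n : ℕ} {z : ℤ → D (n+1)} {k : ℤ} {y : ℤ → D 0}
    (hr : RepW (word0 σ (n+1)) (hh ℓ (n+1)) z k y) (j j' i : ℤ) (h1 : -(hh ℓ n : ℤ) ≤ i)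
    (h2 : i < hh ℓ n) :
    y (j * hh ℓ (n+1) + i - k) = y (j' * hh ℓ (n+1) + i - k) := by
  obtain ⟨b, c, hbc⟩ := hpr n
  have hw := word0_length hlen n
  have hHe : hh ℓ (n+1) = ℓ n * hh ℓ n := rfl
  have hl1 : ℓ n = (ℓ n - 1) + 1 := by have := hl n; omega
  have hHe' : hh ℓ (n+1) = (ℓ n - 1) * hh ℓ n + hh ℓ n := by
    rw [hHe]; conv_lhs => rw [hl1]
    ring
  rcases lt_or_ge i 0 with hi | hi
  · have key : ∀ j : ℤ, some (y (j * hh ℓ (n+1) + i - k))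
        = (word0 σ n c)[(i + hh ℓ n).toNat]? := by
      intro j
      have hlt : (i + hh ℓ n).toNat < hh ℓ n := by omega
      have hc : (σ n (z (j-1)))[ℓ n - 1]? = some c := by
        have := (hbc (z (j-1))).2
        rwa [List.getLast?_eq_getElem?, hlen] at this
      have e1 := flatMap_get hw _ hc hlt
      have e2 := hr (j-1) ((ℓ n - 1) * hh ℓ n + (i + hh ℓ n).toNat) (by omega)
      rw [← e1]
      refine Eq.trans ?_ e2.symm
      congr 2
      have h3 : (hh ℓ (n+1) : ℤ) = ((ℓ n - 1 : ℕ) : ℤ) * hh ℓ n + hh ℓ n := by exact_mod_cast hHe'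
      rw [Nat.cast_add, Int.toNat_of_nonneg (by omega), Nat.cast_mul]
      linear_combination h3
    exact Option.some.inj ((key j).trans (key j').symm)
  · have key : ∀ j : ℤ, some (y (j * hh ℓ (n+1) + i - k)) = (word0 σ n b)[i.toNat]? := by
      intro j
      have hlt : i.toNat < hh ℓ n := by omega
      have hc : (σ n (z j))[0]? = some b := by
        have := (hbc (z j)).1
        rwa [List.head?_eq_getElem?] at this
      have e1 := flatMap_get hw _ hc hlt
      have e2 := hr j (0 * hh ℓ n + i.toNat) (by omega)
      rw [← e1]
      refine Eq.trans ?_ e2.symm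
      congr 2
      rw [zero_mul, zero_add, Int.toNat_of_nonneg hi]
    exact Option.some.inj ((key j).trans (key j').symm)

theorem periodic_of_blocks {y : ℤ → A} {H : ℕ} (hH : 0 < H) {k : ℤ}
    (h : ∀ j j' i : ℤ, 0 ≤ i → i < H → y (j * H + i - k) = y (j' * H + i - k)) :
    IsPeriodicPoint y := by
  have hHz : (0:ℤ) < H := by exact_mod_cast hH
  refine ⟨H, hH, fun i => ?_⟩
  have h1 := Int.emod_nonneg (i + k) hHz.ne'
  have h2 := Int.emod_lt_of_pos (i + k) hHz
  have h3 := Int.emod_add_mul_ediv (i + k) H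
  have := h ((i + k) / H + 1) ((i + k) / H) _ h1 h2
  have e1 : ((i + k) / H + 1) * H + (i + k) % H - k = i + H := by linear_combination h3
  have e2 : ((i + k) / H) * H + (i + k) % H - k = i := by linear_combination h3
  rwa [e1, e2] at this

theorem goodCuts_of_strong [Fintype A] [TopologicalSpace A] [DiscreteTopology A]
    {X : Set (ℤ → A)} (hX : IsToeplitzSubshift X)
    (hap : ∀ x ∈ X, IsAperiodicPoint x) (hS : IsStrongToeplitzOfRank X 2)
    {x : ℤ → A} (hx : x ∈ X) : GoodCuts X x := by
  obtain ⟨D, iD, σ, hne, hcl, _, hpr, hrec, hrank, hconj⟩ := hS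
  have hclX : IsClosed X := by
    obtain ⟨g, _, rfl⟩ := hX
    exact isClosed_closure
  obtain ⟨y, hy, ⟨r1, hr1⟩, ⟨r2, hr2⟩⟩ := @conj_codes A (D 0) _ _ _ _ ⊥
    (@DiscreteTopology.mk (D 0) ⊥ rfl) X (XLevel σ 0) hclX
    (fun x hx a => shiftBy_mem_of_toeplitz hX hx a) (fun z hz a => shiftBy_mem_XLevel hz a)
    hconj x hx
  have hlex : ∀ n, ∃ l, 0 < l ∧ ∀ a, (σ n a).length = l := by
    intro n
    rcases isEmpty_or_nonempty (D (n+1)) with h | ⟨⟨a⟩⟩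
    · exact ⟨1, one_pos, fun a => h.elim a⟩
    · exact ⟨(σ n a).length, List.length_pos_iff.2 (hne n a), fun b => hcl n b a⟩
  choose ℓ hl hlen using hlex
  have hyap : ¬ IsPeriodicPoint y := by
    rintro ⟨p, hp, hper⟩
    refine hap x hx ⟨p, hp, fun a => hr1 _ _ fun i _ _ => ?_⟩
    rw [← hper (a + i)]; congr 1; ring
  have hhpos : ∀ n, 0 < hh ℓ n := by
    intro n
    induction n with
    | zero => exact one_pos
    | succ n ih => exact Nat.mul_pos (hl n) ih
  have hl2 : ∀ n, 2 ≤ ℓ n := by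
    intro n
    by_contra hlt
    have h1 : ℓ n = 1 := by have := hl n; omega
    obtain ⟨z, hz, k, hk, hr⟩ := exists_rep hl hlen hy (n+1)
    have hHe : hh ℓ (n+1) = hh ℓ n := by show ℓ n * hh ℓ n = _; rw [h1, one_mul]
    apply hyap
    apply periodic_of_blocks (hhpos (n+1)) (k := k)
    intro j j' i hi hi'
    exact proper_rep hl hlen hpr hr j j' i (by omega) (by rw [← hHe]; exact hi')
  have hhge : ∀ n, n < hh ℓ n := by
    intro n
    induction n with
    | zero => exact one_pos
    | succ n ih =>
      have : 2 * hh ℓ n ≤ ℓ n * hh ℓ n := Nat.mul_le_mul_right _ (hl2 n)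
      show n + 1 < ℓ n * hh ℓ n
      omega
  intro p hp hps m
  obtain ⟨N, hN⟩ := hps.al hX hx
  obtain ⟨n', hn', hcard⟩ := hrank (r1 + m + N + 3)
  obtain ⟨n, rfl⟩ : ∃ n, n' = n + 1 := ⟨n' - 1, by omega⟩
  obtain ⟨z, hz, k, hk, hr⟩ := exists_rep hl hlen hy (n+1)
  have hpro := proper_rep hl hlen hpr hr
  have hn := hhge n
  have hHpos := hhpos (n+1)
  have hhH : hh ℓ n ≤ hh ℓ (n+1) := Nat.le_mul_of_pos_left _ (hl n)
  obtain ⟨N1, hN1⟩ := al_level hl hlen hrec hy (n+1)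
  set H := hh ℓ (n+1) with hH
  have hHz : (0:ℤ) < H := by exact_mod_cast hHpos
  have hxc : ∀ j j' i : ℤ, -(m + 1 + N : ℤ) ≤ i → i ≤ m + 1 + N →
      x (j * H + i - k) = x (j' * H + i - k) := by
    intro j j' i h1 h2
    apply hr1
    intro i' h3 h4
    have := hpro j j' (i + i') (by omega) (by omega)
    rw [show j * (H:ℤ) + i - k + i' = j * H + (i + i') - k by ring,
      show j' * (H:ℤ) + i - k + i' = j' * H + (i + i') - k by ring]
    exact this
  have hxb : ∀ j j' : ℤ, z j = z j' → ∀ i : ℤ, 0 ≤ i → i < H →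
      x (j * H + i - k) = x (j' * H + i - k) := by
    intro j j' hjj i h1 h2
    apply hr1
    intro i' h3 h4
    rw [show j * (H:ℤ) + i - k + i' = j * H + (i + i') - k by ring,
      show j' * (H:ℤ) + i - k + i' = j' * H + (i + i') - k by ring]
    rcases lt_or_ge (i + i') 0 with h5 | h5
    · exact hpro j j' (i + i') (by omega) (by omega)
    rcases lt_or_ge (i + i') H with h6 | h6
    · obtain ⟨d, hd⟩ := Int.eq_ofNat_of_zero_le h5
      have e1 := hr j d (by omega)
      have e2 := hr j' d (by omega)
      rw [hjj, e2] at e1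
      rw [hd]
      exact (Option.some.inj e1).symm
    · have := hpro (j + 1) (j' + 1) (i + i' - H) (by omega) (by omega)
      rw [show j * (H:ℤ) + (i + i') - k = (j + 1) * H + (i + i' - H) - k by ring,
        show j' * (H:ℤ) + (i + i') - k = (j' + 1) * H + (i + i' - H) - k by ring]
      exact this
  -- the cut
  let bw : ℤ → List A := fun j => factorAt x (j * H - k) H
  have hbw : ∀ j j', z j = z j' → bw j = bw j' := by
    intro j j' hjj
    apply factorAt_congr.2
    intro d hd
    have := hxb j j' hjj d (by omega) (by omega)
    rw [show j * (H:ℤ) - k + d = j * H + d - k by ring,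
      show j' * (H:ℤ) - k + d = j' * H + d - k by ring]
    exact this
  obtain ⟨j0, j1, h01⟩ : ∃ j0 j1, bw j0 ≠ bw j1 := by
    by_contra hcon
    push Not at hcon
    apply hap x hx
    apply periodic_of_blocks hHpos (k := k)
    intro j j' i h1 h2
    obtain ⟨d, rfl⟩ := Int.eq_ofNat_of_zero_le h1
    have := factorAt_congr.1 (hcon j j') d (by omega)
    rw [show j * (H:ℤ) + d - k = j * H - k + d by ring,
      show j' * (H:ℤ) + d - k = j' * H - k + d by ring]
    exact this
  have hz01 : z j0 ≠ z j1 := fun h => h01 (hbw _ _ h)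
  have htwo : ∀ j, bw j = bw j0 ∨ bw j = bw j1 := by
    intro j
    classical
    by_contra hcon
    push Not at hcon
    have a0 : z j ≠ z j0 := fun h => hcon.1 (hbw _ _ h)
    have a1 : z j ≠ z j1 := fun h => hcon.2 (hbw _ _ h)
    have h3 : ({z j, z j0, z j1} : Finset (D (n+1))).card = 3 :=
      Finset.card_eq_three.2 ⟨_, _, _, a0, a1, hz01, rfl⟩
    have h4 := @Finset.card_le_univ _ (iD (n+1)) ({z j, z j0, z j1} : Finset (D (n+1)))
    omega
  have ht1 := Int.emod_nonneg (-k : ℤ) hHz.ne'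
  have ht2 := Int.emod_lt_of_pos (-k : ℤ) hHz
  have ht3 := Int.emod_add_mul_ediv (-k : ℤ) H
  obtain ⟨t, ht⟩ := Int.eq_ofNat_of_zero_le ht1
  set s := (-k : ℤ) / H with hs
  rw [ht] at ht3 ht2
  have hcut : cutWords x H t = {bw j0, bw j1} := by
    have hpos : ∀ j : ℤ, (t : ℤ) + j * H = (j - s) * H - k := by
      intro j; linear_combination ht3
    ext w
    constructor
    · rintro ⟨j, rfl⟩
      rw [hpos]
      exact htwo (j - s)
    · have : ∀ j, bw j ∈ cutWords x H t := fun j => ⟨j + s, by rw [hpos]; simp [bw]⟩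
      rintro (rfl | rfl)
      · exact this j0
      · exact this j1
  have hHm : H = (m + 1) + (H - (m + 1)) := by omega
  have hHm' : H = (H - (m + 1)) + (m + 1) := by omega
  refine ⟨H, t, ⟨by omega, bw j0, bw j1, h01, hcut⟩, ?_, ?_, bw j0, bw j1, h01, hcut, ?_, ?_⟩
  · have := hN (1 * H + 0 - k) (0 * H + 0 - k) (fun i h1 h2 => by
      have := hxc 1 0 i (by omega) (by omega)
      rw [show 1 * (H:ℤ) + 0 - k + i = 1 * H + i - k by ring,
        show 0 * (H:ℤ) + 0 - k + i = 0 * H + i - k by ring]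
      exact this)
    have e : (1 * H + 0 - k - (0 * H + 0 - k) : ℤ) = H := by ring
    rw [e] at this
    exact_mod_cast this
  · apply dividesScale_of_Al hX hap hx (N := N1 + r2)
    intro a b hab
    apply hN1
    intro i h1 h2
    apply hr2
    intro i' h3 h4
    rw [add_assoc, add_assoc]
    exact hab (i + i') (by push_cast; omega) (by push_cast; omega)
  · have htk : ∀ j, (bw j).take (m+1) = factorAt x (j * H - k) (m+1) := by
      intro j
      show (factorAt x (j * H - k) H).take (m+1) = _
      conv_lhs => rw [hHm, factorAt_append]
      rw [← hHm]
      exact List.take_left' (factorAt_length _ _ _)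
    refine ⟨by rw [factorAt_length]; omega, by rw [factorAt_length]; omega, ?_⟩
    rw [htk, htk, factorAt_congr]
    intro d hd
    have := hxc j0 j1 d (by omega) (by omega)
    rw [show j0 * (H:ℤ) - k + d = j0 * H + d - k by ring,
      show j1 * (H:ℤ) - k + d = j1 * H + d - k by ring]
    exact this
  · have htk : ∀ j, (bw j).reverse.take (m+1) =
        (factorAt x (j * H - k + (H - (m+1) : ℕ)) (m+1)).reverse := by
      intro j
      have e : bw j = factorAt x (j * H - k) (H - (m+1)) ++
          factorAt x (j * H - k + (H - (m+1) : ℕ)) (m+1) := by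
        rw [← factorAt_append, ← hHm']
      rw [e, List.reverse_append]
      exact List.take_left' (by rw [List.length_reverse, factorAt_length])
    refine ⟨by rw [List.length_reverse, factorAt_length]; omega,
      by rw [List.length_reverse, factorAt_length]; omega, ?_⟩
    rw [htk, htk]
    congr 1
    rw [factorAt_congr]
    intro d hd
    have := hxc (j0 + 1) (j1 + 1) (d - (m + 1)) (by omega) (by omega)
    have e : ((H - (m+1) : ℕ) : ℤ) = H - (m + 1) := by omega
    rw [show j0 * (H:ℤ) - k + (H - (m+1) : ℕ) + d = (j0 + 1) * H + (d - (m + 1)) - k by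
        rw [e]; ring,
      show j1 * (H:ℤ) - k + (H - (m+1) : ℕ) + d = (j1 + 1) * H + (d - (m + 1)) - k by
        rw [e]; ring]
    exact this

/-- For an aperiodic Toeplitz subshift `X`, the following are
equivalent: (1) `X` is a strong Toeplitz subshift of rank 2; (2) every `x ∈ X`
has arbitrarily fine strong rank-2 cuts compatible with the scale, whose two cut
words have long common prefixes and suffixes; (3) some `x ∈ X` does. -/
theorem statement6 {A : Type*} [Fintype A] [TopologicalSpace A] [DiscreteTopology A]
    (X : Set (ℤ → A)) (hX : IsToeplitzSubshift X)
    (hap : ∀ x ∈ X, IsAperiodicPoint x) :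
    (IsStrongToeplitzOfRank X 2 ↔ ∀ x ∈ X, GoodCuts X x) ∧
    (IsStrongToeplitzOfRank X 2 ↔ ∃ x ∈ X, GoodCuts X x) := by
  have hne : ∃ x, x ∈ X := by
    obtain ⟨x, hg⟩ := id hX
    exact ⟨x, generator_mem hg⟩
  have h12 : IsStrongToeplitzOfRank X 2 → ∀ x ∈ X, GoodCuts X x :=
    fun h x hx => goodCuts_of_strong hX hap h hx
  have h31 : (∃ x ∈ X, GoodCuts X x) → IsStrongToeplitzOfRank X 2 :=
    fun ⟨x, hx, hG⟩ => strong_of_goodCuts hX hap hx hG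
  obtain ⟨x0, hx0⟩ := hne
  exact ⟨⟨h12, fun h => h31 ⟨x0, hx0, h x0 hx0⟩⟩, ⟨fun h => ⟨x0, hx0, h12 h x0 hx0⟩, h31⟩⟩

end ToeplitzFR
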